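/- Let F be an algebraically closed field of characteristic 0, let f ∈ F[X] be a disintegrated polynomial of degree d ≥ 2, let M(f^∞) be the group of linear polynomials in F[X] commuting with some iterate of f, and let f̃ ∈ F[X] be a polynomial of lowest degree among polynomials of degree at least 2 commuting with some iterate of f. Then {f̃^m ∘ L : m ≥ 0, L ∈ M(f^∞)} = {L ∘ f̃^m : m ≥ 0, L ∈ M(f^∞)}, and this set is exactly the set of all polynomials g ∈ F[X] that commute with some iterate of f. -/

import Mathlib

open Polynomial

/-- The `m`-th compositional iterate of a polynomial. -/
noncomputable def polIter {F : Type} [CommSemiring F] (f : Polynomial F) : ℕ → Polynomial F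
  | 0 => X
  | m + 1 => f.comp (polIter f m)

/-- Two polynomials commute under composition. -/
def PolyCommute {F : Type} [CommSemiring F] (f g : Polynomial F) : Prop :=
  f.comp g = g.comp f

/-- `g` commutes with some iterate `f^m` (`m ≥ 1`) of `f`. -/
def CommutesWithIterate {F : Type} [CommSemiring F] (f g : Polynomial F) : Prop :=
  ∃ m : ℕ, 1 ≤ m ∧ PolyCommute (polIter f m) g

/-- `c` is the Chebyshev polynomial of degree `d`, characterized by
`c(x + 1/x) = x^d + 1/x^d`. -/
def IsChebyshevPoly {F : Type} [Field F] (d : ℕ) (c : Polynomial F) : Prop :=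
  ∀ x : F, x ≠ 0 → c.eval (x + x⁻¹) = x ^ d + (x⁻¹) ^ d

/-- A polynomial over an algebraically closed field (or any field containing the relevant
conjugating data) is special if it is affinely conjugate to `X^d` or to `±C_d`. -/
def IsSpecialPolyAux {F : Type} [Field F] (f : Polynomial F) : Prop :=
  ∃ (a b : F), a ≠ 0 ∧
    ∃ g : Polynomial F,
      (g = X ^ f.natDegree ∨ IsChebyshevPoly f.natDegree g ∨
        IsChebyshevPoly f.natDegree (-g)) ∧
      (C a * X + C b).comp g = f.comp (C a * X + C b)

/-- A polynomial over `K` is special if it becomes special (conjugate to `X^d` or `±C_d`)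
over an algebraic closure of `K`. -/
def IsSpecialPoly {K : Type} [Field K] (f : Polynomial K) : Prop :=
  IsSpecialPolyAux (f.map (algebraMap K (AlgebraicClosure K)))

/-- A polynomial of degree at least 2 is disintegrated if it is not special. -/
def IsDisintegrated {K : Type} [Field K] (f : Polynomial K) : Prop :=
  2 ≤ f.natDegree ∧ ¬ IsSpecialPoly f

/-- A point of `P^1` is periodic under (the `P^1`-action of) a polynomial. -/
def P1Periodic {L : Type} [CommRing L] (f : Polynomial L) (ζ : OnePoint L) : Prop :=
  ∃ N : ℕ, 1 ≤ N ∧ (OnePoint.map fun a => f.eval a)^[N] ζ = ζ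

/-- A point of `P^1` is preperiodic under a polynomial. -/
def P1Preperiodic {L : Type} [CommRing L] (f : Polynomial L) (ζ : OnePoint L) : Prop :=
  ∃ k : ℕ, P1Periodic f ((OnePoint.map fun a => f.eval a)^[k] ζ)


/-- For an algebraically closed base field, `f` is disintegrated if it is not affinely
conjugate (over the field itself) to `X^d` or `±C_d`. -/
def IsDisintegratedAux {F : Type} [Field F] (f : Polynomial F) : Prop :=
  2 ≤ f.natDegree ∧ ¬ IsSpecialPolyAux f

/-- `M(f^∞)`: the collection of linear polynomials commuting with some iterate of `f`. -/
def linCommSet {F : Type} [Field F] (f : Polynomial F) : Set (Polynomial F) :=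
  {L : Polynomial F | L.natDegree = 1 ∧ CommutesWithIterate f L}

section Iterates

variable {F : Type} [Field F]

theorem comp_right_cancel {p q u : F[X]} (hu : u.natDegree ≠ 0) (h : p.comp u = q.comp u) :
    p = q := by
  have h1 : (p - q).comp u = 0 := by rw [sub_comp, h, sub_self]
  rcases comp_eq_zero_iff.mp h1 with h2 | ⟨_, h2⟩
  · exact sub_eq_zero.mp h2
  · exact absurd (by rw [h2, natDegree_C]) hu

theorem polIter_zero (f : F[X]) : polIter f 0 = X := rfl

theorem polIter_succ (f : F[X]) (m : ℕ) : polIter f (m + 1) = f.comp (polIter f m) := rfl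

theorem polIter_one (f : F[X]) : polIter f 1 = f := by
  rw [polIter_succ, polIter_zero, comp_X]

theorem polIter_add (f : F[X]) (m n : ℕ) :
    polIter f (m + n) = (polIter f m).comp (polIter f n) := by
  induction m with
  | zero => rw [zero_add, polIter_zero, X_comp]
  | succ m ih => rw [Nat.succ_add, polIter_succ, ih, polIter_succ, comp_assoc]

theorem polIter_mul (f : F[X]) (m n : ℕ) : polIter f (m * n) = polIter (polIter f m) n := by
  induction n with
  | zero => rfl
  | succ n ih => rw [Nat.mul_succ, add_comm, polIter_add, ih, polIter_succ]

theorem natDegree_polIter (f : F[X]) (m : ℕ) : (polIter f m).natDegree = f.natDegree ^ m := by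
  induction m with
  | zero => rw [polIter_zero, natDegree_X, pow_zero]
  | succ m ih => rw [polIter_succ, natDegree_comp, ih, pow_succ']

theorem PolyCommute.symm {p q : F[X]} (h : PolyCommute p q) : PolyCommute q p := Eq.symm h

theorem PolyCommute.comp_right {p q r : F[X]} (hq : PolyCommute p q) (hr : PolyCommute p r) :
    PolyCommute p (q.comp r) := by
  unfold PolyCommute at *
  rw [← comp_assoc, hq, comp_assoc, hr, comp_assoc]

theorem PolyCommute.polIter_right {p q : F[X]} (h : PolyCommute p q) (m : ℕ) :
    PolyCommute p (polIter q m) := by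
  induction m with
  | zero => simp [PolyCommute, polIter_zero]
  | succ m ih => exact h.comp_right ih

theorem PolyCommute.polIter_left {p q : F[X]} (h : PolyCommute p q) (m : ℕ) :
    PolyCommute (polIter p m) q :=
  (h.symm.polIter_right m).symm

theorem polyCommute_polIter_polIter (f : F[X]) (m n : ℕ) :
    PolyCommute (polIter f m) (polIter f n) := by
  unfold PolyCommute
  rw [← polIter_add, ← polIter_add, add_comm]

/-- Cancelling the right factor `u` in a composition `h ∘ u` that commutes with `p`. -/
theorem PolyCommute.of_comp {p h u : F[X]} (hu : u.natDegree ≠ 0) (h1 : PolyCommute p (h.comp u))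
    (h2 : PolyCommute p u) : PolyCommute p h := by
  apply comp_right_cancel hu
  rw [comp_assoc, comp_assoc, h2, ← comp_assoc h u p]
  exact h1

theorem CommutesWithIterate.comp {f g h : F[X]} (hg : CommutesWithIterate f g)
    (hh : CommutesWithIterate f h) : CommutesWithIterate f (g.comp h) := by
  obtain ⟨m, hm, hg⟩ := hg
  obtain ⟨n, hn, hh⟩ := hh
  refine ⟨m * n, Nat.mul_pos hm hn, PolyCommute.comp_right ?_ ?_⟩
  · rw [polIter_mul]; exact hg.polIter_left n
  · rw [mul_comm, polIter_mul]; exact hh.polIter_left m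

theorem CommutesWithIterate.polIter_iterate {f g : F[X]} (hg : CommutesWithIterate f g) (m : ℕ) :
    CommutesWithIterate f (polIter g m) := by
  obtain ⟨n, hn, hg⟩ := hg
  exact ⟨n, hn, hg.polIter_right m⟩

theorem exists_linear_inverse {L : F[X]} (hL : L.natDegree = 1) :
    ∃ L' : F[X], L'.natDegree = 1 ∧ L.comp L' = X ∧ L'.comp L = X := by
  obtain ⟨a, ha, b, rfl⟩ := natDegree_eq_one.mp hL
  refine ⟨C a⁻¹ * X + C (-(a⁻¹ * b)), natDegree_linear (inv_ne_zero ha), ?_, ?_⟩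
  · simp only [add_comp, mul_comp, C_comp, X_comp, mul_add, ← mul_assoc, ← C_mul,
      mul_inv_cancel₀ ha, C_1, one_mul, mul_neg, C_neg]
    ring
  · simp only [add_comp, mul_comp, C_comp, X_comp, mul_add, ← mul_assoc, ← C_mul,
      inv_mul_cancel₀ ha, C_1, one_mul, C_neg, neg_comp]
    ring

end Iterates

section CommonDivisor

variable {K : Type} [Field K]

/-- The difference `p(Y) - p(X)`, with `Y` the outer variable of `K[X][Y]`. -/
noncomputable def diffPoly (p : K[X]) : K[X][X] := p.map C - C p

theorem diffPoly_comp_dvd (a x : K[X]) : diffPoly x ∣ diffPoly (a.comp x) := by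
  have h := sub_dvd_eval_sub (x.map C : K[X][X]) (C x) ((a.map C).map C)
  have h1 : ((a.map C).map C : K[X][X][X]).eval (x.map C) = (a.comp x).map C := by
    rw [map_comp, comp, eval₂_eq_eval_map]
  have h2 : ((a.map C).map C : K[X][X][X]).eval (C x) = C (a.comp x) := by
    rw [comp, eval_map, eval₂_map, hom_eval₂]
  rwa [h1, h2] at h

theorem diffPoly_coeff (p : K[X]) (k : ℕ) :
    (diffPoly p).coeff k = C (p.coeff k) - if k = 0 then p else 0 := by
  rw [diffPoly, coeff_sub, coeff_map, coeff_C]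

theorem natDegree_diffPoly (p : K[X]) : (diffPoly p).natDegree = p.natDegree := by
  rw [diffPoly, natDegree_sub_C, natDegree_map]

/-- The substitution `X ↦ z`, `Y ↦ v z` from `K[X][Y]` to `K[v][z]`. -/
noncomputable def homogSubst (K : Type) [Field K] : K[X][X] →+* K[X][X] :=
  eval₂RingHom (mapRingHom C) (C X * X)

theorem homogSubst_coeff_coeff (r : K[X][X]) (k j : ℕ) :
    ((homogSubst K r).coeff k).coeff j = if j ≤ k then (r.coeff j).coeff (k - j) else 0 := by
  induction r using Polynomial.induction_on' with
  | add p q hp hq =>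
    rw [map_add, coeff_add, coeff_add, hp, hq, coeff_add, coeff_add]
    split_ifs <;> simp
  | monomial n p =>
    have h1 : homogSubst K (monomial n p) = C (X ^ n) * (p.map C * X ^ n) := by
      simp only [homogSubst, coe_eval₂RingHom, eval₂_monomial, coe_mapRingHom, mul_pow, C_pow]
      ring
    rw [h1, coeff_C_mul, coeff_mul_X_pow', coeff_monomial]
    by_cases hnk : n ≤ k
    · rw [if_pos hnk, coeff_map, mul_comm, coeff_C_mul, coeff_X_pow]
      by_cases hjn : n = j
      · subst hjn; simp [hnk]
      · simp [hjn, Ne.symm hjn]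
    · rw [if_neg hnk]
      by_cases hjn : n = j
      · subst hjn; simp [hnk]
      · simp [hjn]

theorem natDegree_homogSubst_coeff_le (r : K[X][X]) (k : ℕ) :
    ((homogSubst K r).coeff k).natDegree ≤ r.natDegree := by
  rw [natDegree_le_iff_coeff_eq_zero]
  intro j hj
  rw [homogSubst_coeff_coeff, coeff_eq_zero_of_natDegree_lt hj]
  simp

theorem le_natDegree_homogSubst {r : K[X][X]} {j : ℕ} (hj : r.coeff j ≠ 0) :
    (r.coeff j).natDegree + j ≤ (homogSubst K r).natDegree := by
  apply le_natDegree_of_ne_zero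
  intro h
  have h1 := homogSubst_coeff_coeff r ((r.coeff j).natDegree + j) j
  rw [h, if_pos (Nat.le_add_left _ _), Nat.add_sub_cancel, coeff_zero] at h1
  exact hj (leadingCoeff_eq_zero.mp h1.symm)

theorem natDegree_le_natDegree_homogSubst (r : K[X][X]) :
    r.natDegree ≤ (homogSubst K r).natDegree := by
  by_cases hr : r = 0
  · simp [hr]
  · exact (Nat.le_add_left _ _).trans (le_natDegree_homogSubst (leadingCoeff_ne_zero.mpr hr))

theorem homogSubst_diffPoly_coeff (p : K[X]) (k : ℕ) :
    (homogSubst K (diffPoly p)).coeff k = C (p.coeff k) * (X ^ k - 1) := by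
  ext j
  rw [homogSubst_coeff_coeff, diffPoly_coeff, coeff_C_mul, coeff_sub, coeff_sub, coeff_X_pow,
    coeff_one, coeff_C]
  by_cases hj : j = 0 <;> by_cases hk : k = 0 <;> by_cases hjk : j = k
  all_goals try subst hj
  all_goals try subst hk
  all_goals try subst hjk
  all_goals simp_all
  · intro h h2; omega

theorem natDegree_homogSubst_diffPoly (p : K[X]) :
    (homogSubst K (diffPoly p)).natDegree = p.natDegree := by
  apply le_antisymm
  · rw [natDegree_le_iff_coeff_eq_zero]
    intro k hk
    rw [homogSubst_diffPoly_coeff, coeff_eq_zero_of_natDegree_lt hk, C_0, zero_mul]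
  · exact (natDegree_diffPoly p).ge.trans (natDegree_le_natDegree_homogSubst _)

theorem leadingCoeff_homogSubst_diffPoly (p : K[X]) :
    (homogSubst K (diffPoly p)).leadingCoeff = C p.leadingCoeff * (X ^ p.natDegree - 1) := by
  rw [leadingCoeff, natDegree_homogSubst_diffPoly, homogSubst_diffPoly_coeff, leadingCoeff]

theorem diffPoly_ne_zero {p : K[X]} (hp : p.natDegree ≠ 0) : diffPoly p ≠ 0 := by
  intro h
  rw [← natDegree_diffPoly, h, natDegree_zero] at hp
  exact hp rfl

/-- Divisors of `p(Y) - p(X)` have total degree equal to their degree in `Y`. -/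
theorem natDegree_coeff_add_le_of_dvd_diffPoly {p : K[X]} (hp : p.natDegree ≠ 0) {r : K[X][X]}
    (hr : r ∣ diffPoly p) {j : ℕ} (hj : r.coeff j ≠ 0) :
    (r.coeff j).natDegree + j ≤ r.natDegree := by
  obtain ⟨s, hs⟩ := hr
  have h0 := diffPoly_ne_zero hp
  have hr0 : r ≠ 0 := by rintro rfl; exact h0 (by rw [hs, zero_mul])
  have hs0 : s ≠ 0 := by rintro rfl; exact h0 (by rw [hs, mul_zero])
  have h1 : r.natDegree + s.natDegree = p.natDegree := by
    rw [← natDegree_mul hr0 hs0, ← hs, natDegree_diffPoly]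
  have h2 : homogSubst K r * homogSubst K s ≠ 0 := by
    rw [← map_mul, ← hs]
    intro h
    have := natDegree_homogSubst_diffPoly p
    rw [h, natDegree_zero] at this
    exact hp this.symm
  have h3 : (homogSubst K r).natDegree + (homogSubst K s).natDegree = p.natDegree := by
    rw [← natDegree_mul (left_ne_zero_of_mul h2) (right_ne_zero_of_mul h2), ← map_mul, ← hs,
      natDegree_homogSubst_diffPoly]
  have h4 := natDegree_le_natDegree_homogSubst s
  have h5 := le_natDegree_homogSubst hj
  omega

theorem exists_dvd_diffPoly_gcd_le [CharZero K] {a b x y : K[X]} (ha : a.natDegree ≠ 0)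
    (hx : x.natDegree ≠ 0) (hab : a.comp x = b.comp y) :
    ∃ h : K[X][X], h ∣ diffPoly x ∧ h ∣ diffPoly y ∧
      Nat.gcd x.natDegree y.natDegree ≤ h.natDegree := by
  obtain ⟨A, B, h, hAB, hA, hB⟩ :=
    UniqueFactorizationMonoid.exists_reduced_factors (diffPoly x) (diffPoly_ne_zero hx) (diffPoly y)
  have hxP : diffPoly x ∣ diffPoly (a.comp x) := diffPoly_comp_dvd a x
  have hyP : diffPoly y ∣ diffPoly (a.comp x) := hab ▸ diffPoly_comp_dvd b y
  have hPdeg : (a.comp x).natDegree ≠ 0 := by rw [natDegree_comp]; exact mul_ne_zero ha hx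
  refine ⟨h, ⟨A, hA.symm⟩, ⟨B, hB.symm⟩, ?_⟩
  have hh0 : h ≠ 0 := by
    rintro rfl
    exact diffPoly_ne_zero hx (by rw [← hA, zero_mul])
  have hprod : h * (A * B) ∣ diffPoly (a.comp x) := by
    rw [← hA] at hxP
    rw [← hB] at hyP
    obtain ⟨q, hq⟩ := (dvd_mul_right h A).trans hxP
    rw [hq] at hxP hyP ⊢
    exact mul_dvd_mul_left h (hAB.mul_dvd ((mul_dvd_mul_iff_left hh0).mp hxP)
      ((mul_dvd_mul_iff_left hh0).mp hyP))
  set lam := (homogSubst K h).leadingCoeff with hlam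
  set al := (homogSubst K A).leadingCoeff with hal
  set be := (homogSubst K B).leadingCoeff with hbe
  have e1 : lam * al = C x.leadingCoeff * (X ^ x.natDegree - 1) := by
    rw [← leadingCoeff_homogSubst_diffPoly, ← hA, map_mul, leadingCoeff_mul]
  have e2 : lam * be = C y.leadingCoeff * (X ^ y.natDegree - 1) := by
    rw [← leadingCoeff_homogSubst_diffPoly, ← hB, map_mul, leadingCoeff_mul]
  have e3 : lam * (al * be) ∣
      C (a.comp x).leadingCoeff * (X ^ (a.comp x).natDegree - 1) := by
    rw [← leadingCoeff_homogSubst_diffPoly, hal, hbe, hlam, ← leadingCoeff_mul,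
      ← leadingCoeff_mul, ← map_mul, ← map_mul]
    obtain ⟨q, hq⟩ := hprod
    rw [hq, map_mul (homogSubst K) _ q, leadingCoeff_mul]
    exact dvd_mul_right _ _
  have hunit : ∀ {p : K[X]}, p.natDegree ≠ 0 → IsUnit (C p.leadingCoeff) := fun {p} hp => by
    rw [isUnit_C, isUnit_iff_ne_zero, Ne, leadingCoeff_eq_zero]
    rintro rfl
    exact hp natDegree_zero
  have hsep : (lam * (al * be)).Separable :=
    Separable.of_dvd (X_pow_sub_one_separable_iff.mpr (Nat.cast_ne_zero.mpr hPdeg))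
      ((hunit hPdeg).dvd_mul_left.mp e3)
  obtain ⟨u, w, huw⟩ := hsep.of_mul_right.isCoprime
  have hdvd : ∀ n, Nat.gcd x.natDegree y.natDegree ∣ n →
      (X ^ Nat.gcd x.natDegree y.natDegree - 1 : K[X]) ∣ X ^ n - 1 := by
    rintro _ ⟨k, rfl⟩
    rw [pow_mul]
    exact sub_one_dvd_pow_sub_one _ _
  have d1 : (X ^ Nat.gcd x.natDegree y.natDegree - 1 : K[X]) ∣ lam * al :=
    e1 ▸ (hdvd _ (Nat.gcd_dvd_left _ _)).mul_left _
  have d2 : (X ^ Nat.gcd x.natDegree y.natDegree - 1 : K[X]) ∣ lam * be :=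
    e2 ▸ (hdvd _ (Nat.gcd_dvd_right _ _)).mul_left _
  have d3 : (X ^ Nat.gcd x.natDegree y.natDegree - 1 : K[X]) ∣ lam := by
    have : lam = u * (lam * al) + w * (lam * be) := by linear_combination (-lam) * huw
    rw [this]
    exact dvd_add (d1.mul_left _) (d2.mul_left _)
  have hlam0 : lam ≠ 0 := by
    intro h0
    rw [h0, zero_mul] at hsep
    exact not_separable_zero hsep
  have := natDegree_le_of_dvd d3 hlam0
  rw [← C_1, natDegree_X_pow_sub_C] at this
  exact this.trans (natDegree_homogSubst_coeff_le _ _)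

end CommonDivisor

section Engstrom

variable {K : Type} [Field K]

theorem exists_eq_comp_of_eval₂_eq {Ω : Type} [Field Ω] {σ : K[X] →+* Ω}
    (hσ : Function.Injective σ) {S : Finset Ω} {w : K[X]} (hw : w.Monic)
    (hwS : w.natDegree = S.card) (hw0 : w.natDegree ≠ 0)
    (hwσ : ∀ ζ ∈ S, w.eval₂ (σ.comp C) ζ = σ w) (p : K[X])
    (hp : ∀ ζ ∈ S, p.eval₂ (σ.comp C) ζ = σ p) : ∃ q : K[X], p = q.comp w := by
  have hmap : ∀ (p : K[X]) (ζ : Ω), ((diffPoly p).map σ).eval ζ = p.eval₂ (σ.comp C) ζ - σ p := by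
    intro p ζ
    simp [diffPoly, eval_map, eval₂_map]
  have hWmonic : (diffPoly w).Monic :=
    (hw.map C).sub_of_left (by
      rw [degree_map]
      exact degree_C_le.trans_lt (natDegree_pos_iff_degree_pos.mp (Nat.pos_of_ne_zero hw0)))
  induction hn : p.natDegree using Nat.strong_induction_on generalizing p with
  | _ n ih =>
  by_cases hp0 : p.natDegree = 0
  · rw [natDegree_eq_zero] at hp0
    obtain ⟨c, rfl⟩ := hp0
    exact ⟨C c, by simp⟩
  have hdvd : diffPoly w ∣ diffPoly p := by
    rw [← modByMonic_eq_zero_iff_dvd hWmonic]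
    apply map_injective σ hσ
    rw [Polynomial.map_zero]
    by_contra hne
    have hcard : S.card ≤ ((diffPoly p %ₘ diffPoly w).map σ).natDegree := by
      apply card_le_degree_of_subset_roots
      intro ζ hζ
      rw [mem_roots hne, IsRoot, map_modByMonic σ hWmonic, modByMonic_eq_sub_mul_div,
        eval_sub, eval_mul, hmap, hmap, hp ζ hζ, hwσ ζ hζ]
      simp
    rw [natDegree_map_eq_of_injective hσ] at hcard
    have := natDegree_modByMonic_lt (diffPoly p) hWmonic (by
      intro h1
      have := natDegree_diffPoly w
      rw [h1, natDegree_one] at this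
      exact hw0 this.symm)
    rw [natDegree_diffPoly] at this
    omega
  have h0 : ∀ p : K[X], (diffPoly p).map (evalRingHom 0) = p - C (p.eval 0) := by
    intro p
    ext i
    simp [diffPoly, coeff_C]
  obtain ⟨q1, hq1⟩ : w - C (w.eval 0) ∣ p - C (p.eval 0) := by
    rw [← h0, ← h0]; exact Polynomial.map_dvd _ hdvd
  have hwsub : (w - C (w.eval 0)).natDegree = w.natDegree := natDegree_sub_C
  have hq0 : q1 ≠ 0 := by
    rintro rfl
    rw [mul_zero, sub_eq_zero] at hq1
    exact hp0 (by rw [hq1, natDegree_C])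
  have hwne : w - C (w.eval 0) ≠ 0 := by
    intro h
    rw [h, natDegree_zero] at hwsub
    exact hw0 hwsub.symm
  have hdeg : w.natDegree + q1.natDegree = p.natDegree := by
    rw [← hwsub, ← natDegree_mul hwne hq0, ← hq1, natDegree_sub_C]
  have hpq : p = (w - C (w.eval 0)) * q1 + C (p.eval 0) := by rw [← hq1]; ring
  obtain ⟨q2, hq2⟩ := ih q1.natDegree (by omega) q1 (by
    intro ζ hζ
    have h1 := hp ζ hζ
    rw [hpq] at h1
    simp only [eval₂_add, eval₂_mul, eval₂_sub, eval₂_C, map_add, map_mul, map_sub, hwσ ζ hζ,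
      RingHom.comp_apply, add_left_inj] at h1
    refine mul_left_cancel₀ ?_ h1
    rw [← map_sub]
    exact (map_ne_zero_iff σ hσ).mpr hwne) rfl
  refine ⟨(X - C (w.eval 0)) * q2 + C (p.eval 0), ?_⟩
  conv_lhs => rw [hpq, hq2]
  simp

theorem exists_common_values [IsAlgClosed K] [CharZero K] {x y : K[X]} (hx : x.natDegree ≠ 0)
    {h : K[X][X]} (hhx : h ∣ diffPoly x) (hhy : h ∣ diffPoly y) (hh : h.natDegree ≠ 0) :
    ∃ (Ω : Type) (_ : Field Ω) (σ : K[X] →+* Ω) (S : Finset Ω) (w : K[X]),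
      Function.Injective σ ∧ (∀ ζ ∈ S, x.eval₂ (σ.comp C) ζ = σ x ∧ y.eval₂ (σ.comp C) ζ = σ y ∧
        w.eval₂ (σ.comp C) ζ = σ w) ∧ w.natDegree = S.card ∧ h.natDegree ≤ S.card := by
  classical
  let L := FractionRing K[X]
  let Ω := AlgebraicClosure L
  let i : K[X] →+* L := algebraMap K[X] L
  let j : L →+* Ω := algebraMap L Ω
  have hi : Function.Injective i := IsFractionRing.injective K[X] L
  have hj : Function.Injective j := j.injective
  let σ : K[X] →+* Ω := j.comp i
  have hσ : Function.Injective σ := hj.comp hi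
  let κ : K →+* Ω := σ.comp C
  have hmap : ∀ (p : K[X]) (ζ : Ω), ((diffPoly p).map σ).eval ζ = p.eval₂ κ ζ - σ p := by
    intro p ζ
    simp [diffPoly, eval_map, eval₂_map, κ]
  -- points with `x(ζ) = x` are transcendental over `K`
  have htrans : ∀ ζ : Ω, x.eval₂ κ ζ = σ x → Function.Injective (eval₂RingHom κ ζ) := by
    intro ζ hζ
    rw [injective_iff_map_eq_zero]
    intro p hp
    by_contra hp0
    rw [coe_eval₂RingHom, ← eval_map] at hp
    have hroot : ζ ∈ (p.map κ).roots := (mem_roots (Polynomial.map_ne_zero hp0)).mpr hp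
    rw [(IsAlgClosed.splits p).roots_map κ] at hroot
    obtain ⟨c, -, rfl⟩ := Multiset.mem_map.mp hroot
    rw [eval₂_hom] at hζ
    have : C (x.eval c) = x := hσ hζ
    exact hx (by rw [← this, natDegree_C])
  let lx : K[X][X] := C (C x.leadingCoeff⁻¹)
  have hlc : x.leadingCoeff ≠ 0 := by
    rw [Ne, leadingCoeff_eq_zero]; rintro rfl; exact hx natDegree_zero
  have hmonic : (lx * diffPoly x).Monic := by
    have h1 : (diffPoly x).leadingCoeff = C x.leadingCoeff := by
      rw [leadingCoeff, natDegree_diffPoly, diffPoly_coeff, if_neg hx, sub_zero, leadingCoeff]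
    rw [Monic, leadingCoeff_mul, h1, leadingCoeff_C, ← C_mul, inv_mul_cancel₀ hlc, C_1]
  let G := EuclideanDomain.gcd ((diffPoly x).map i) ((diffPoly y).map i)
  have hGx : G ∣ (diffPoly x).map i := EuclideanDomain.gcd_dvd_left _ _
  have hΔ0 : (diffPoly x).map i ≠ 0 :=
    (Polynomial.map_ne_zero_iff hi).mpr (diffPoly_ne_zero hx)
  have hG0 : G ≠ 0 := ne_zero_of_dvd_ne_zero hΔ0 hGx
  obtain ⟨G', hG'⟩ := IsIntegrallyClosed.eq_map_mul_C_of_dvd (K := L) hmonic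
    (g := G) (by rw [Polynomial.map_mul]; exact hGx.mul_left _)
  have hGlc : G.leadingCoeff ≠ 0 := leadingCoeff_ne_zero.mpr hG0
  have hG'eq : G'.map i = G * C G.leadingCoeff⁻¹ := by
    have h1 := congrArg (fun q => q * C G.leadingCoeff⁻¹) hG'
    simpa only [mul_assoc, ← C_mul, mul_inv_cancel₀ hGlc, C_1, mul_one] using h1
  have hG'monic : G'.Monic := by
    apply monic_of_injective hi
    rw [hG'eq]
    exact monic_mul_leadingCoeff_inv hG0
  have hG'dvd : G' ∣ diffPoly x := by
    rw [← map_dvd_map i hi hG'monic, hG'eq]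
    refine (Dvd.intro (C G.leadingCoeff) ?_ : _ ∣ G).trans hGx
    rw [mul_assoc, ← C_mul, inv_mul_cancel₀ hGlc, C_1, mul_one]
  have hG'dvdy : G'.map i ∣ (diffPoly y).map i := by
    rw [hG'eq]
    refine (Dvd.intro (C G.leadingCoeff) ?_ : _ ∣ G).trans (EuclideanDomain.gcd_dvd_right _ _)
    rw [mul_assoc, ← C_mul, inv_mul_cancel₀ hGlc, C_1, mul_one]
  have hG'deg : G'.natDegree = G.natDegree := by
    rw [← natDegree_map_eq_of_injective hi G', hG'eq,
      natDegree_mul_C (inv_ne_zero hGlc)]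
  have hdegle : h.natDegree ≤ G'.natDegree := by
    rw [hG'deg, ← natDegree_map_eq_of_injective hi h]
    exact natDegree_le_of_dvd
      (EuclideanDomain.dvd_gcd (Polynomial.map_dvd _ hhx) (Polynomial.map_dvd _ hhy)) hG0
  have hmm : G'.map σ = (G'.map i).map j := (Polynomial.map_map i j G').symm
  have hG'σdvd : G'.map σ ∣ (diffPoly x).map σ := Polynomial.map_dvd _ hG'dvd
  have hG'σdvdy : G'.map σ ∣ (diffPoly y).map σ := by
    have h1 := Polynomial.map_dvd j hG'dvdy
    rwa [Polynomial.map_map, Polynomial.map_map] at h1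
  have hxζ : ∀ ζ, (G'.map σ).eval ζ = 0 → x.eval₂ κ ζ = σ x := by
    intro ζ hζ
    obtain ⟨q, hq⟩ := hG'σdvd
    have h1 := hmap x ζ
    rw [hq, eval_mul, hζ, zero_mul] at h1
    exact (sub_eq_zero.mp h1.symm)
  have hyζ : ∀ ζ, (G'.map σ).eval ζ = 0 → y.eval₂ κ ζ = σ y := by
    intro ζ hζ
    obtain ⟨q, hq⟩ := hG'σdvdy
    have h1 := hmap y ζ
    rw [hq, eval_mul, hζ, zero_mul] at h1
    exact (sub_eq_zero.mp h1.symm)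
  have hcoef : ∀ ζ, (G'.map σ).eval ζ = 0 → ∀ n, (G'.coeff n).eval₂ κ ζ = σ (G'.coeff n) := by
    intro ζ hζ n
    have ht := htrans ζ (hxζ ζ hζ)
    let jz : L →+* Ω := IsFractionRing.lift ht
    have hjz : ∀ p : K[X], jz (i p) = p.eval₂ κ ζ := fun p => IsFractionRing.lift_algebraMap ht p
    have hΔ : ∀ p : K[X], p.eval₂ κ ζ = σ p →
        ((diffPoly p).map i).map jz = ((diffPoly p).map i).map j := by
      intro p hp
      ext k
      rw [coeff_map, coeff_map, coeff_map, coeff_map, diffPoly_coeff, hjz]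
      change _ = σ _
      rw [eval₂_sub, eval₂_C, map_sub]
      split_ifs
      · rw [hp]; rfl
      · rw [eval₂_zero, map_zero]; rfl
    have hGj : G.map jz = G.map j := by
      have hG : G = EuclideanDomain.gcd ((diffPoly x).map i) ((diffPoly y).map i) := rfl
      rw [hG, ← gcd_map, ← gcd_map, hΔ x (hxζ ζ hζ), hΔ y (hyζ ζ hζ)]
    have hlcj : jz G.leadingCoeff = j G.leadingCoeff := by
      have := congrArg (fun q => q.coeff G.natDegree) hGj
      simpa only [coeff_map, coeff_natDegree] using this
    have h1 : (G'.map i).map jz = (G'.map i).map j := by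
      rw [hG'eq, Polynomial.map_mul, Polynomial.map_mul, hGj, map_C, map_C, map_inv₀ jz,
        map_inv₀ j, hlcj]
    have h2 := congrArg (fun q => q.coeff n) h1
    simp only [coeff_map, hjz] at h2
    exact h2
  have hsep : ((diffPoly x).map σ).Separable := by
    rw [Separable, isCoprime_iff_aeval_ne_zero_of_isAlgClosed Ω Ω]
    intro ζ
    by_cases hζ : x.eval₂ κ ζ = σ x
    · right
      rw [coe_aeval_eq_eval]
      have h1 : derivative ((diffPoly x).map σ) = (derivative x).map κ := by
        rw [diffPoly, Polynomial.map_sub, derivative_sub, map_C, derivative_C, sub_zero,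
          Polynomial.map_map, derivative_map]
      rw [h1, eval_map]
      intro h2
      have h3 : derivative x = 0 := by
        apply htrans ζ hζ
        rw [coe_eval₂RingHom, h2, eval₂_zero]
      exact hx (derivative_eq_zero.mp h3)
    · left
      rw [coe_aeval_eq_eval, hmap]
      exact sub_ne_zero.mpr hζ
  have hσ0 : G'.map σ ≠ 0 := (hG'monic.map σ).ne_zero
  have hcard : (G'.map σ).roots.toFinset.card = G'.natDegree := by
    rw [Multiset.toFinset_card_of_nodup (nodup_roots (hsep.of_dvd hG'σdvd)),
      IsAlgClosed.card_roots_eq_natDegree, natDegree_map_eq_of_injective hσ]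
  have hmem : ∀ ζ, ζ ∈ (G'.map σ).roots.toFinset ↔ (G'.map σ).eval ζ = 0 := by
    intro ζ
    rw [Multiset.mem_toFinset, mem_roots hσ0, IsRoot]
  obtain ⟨n, hn⟩ : ∃ n, (G'.coeff n).natDegree ≠ 0 := by
    by_contra! hcon
    have hpos : 0 < (G'.map σ).roots.toFinset.card := by omega
    obtain ⟨ζ, hζ⟩ := Finset.card_pos.mp hpos
    rw [hmem] at hζ
    have ht := htrans ζ (hxζ ζ hζ)
    let g : K[X] := G'.map (evalRingHom 0)
    have hgG : g.map C = G' := by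
      ext1 k
      rw [coeff_map, coeff_map, coe_evalRingHom, ← coeff_zero_eq_eval_zero]
      exact (eq_C_of_natDegree_eq_zero (hcon k)).symm
    have hg : g = 0 := by
      apply ht
      rw [coe_eval₂RingHom, eval₂_zero, ← eval_map]
      rw [← hgG, Polynomial.map_map] at hζ
      exact hζ
    rw [hg, Polynomial.map_zero] at hgG
    exact hG'monic.ne_zero hgG.symm
  refine ⟨Ω, inferInstance, σ, (G'.map σ).roots.toFinset, G'.coeff n, hσ, ?_, ?_, ?_⟩
  · intro ζ hζ
    rw [hmem] at hζ
    exact ⟨hxζ ζ hζ, hyζ ζ hζ, hcoef ζ hζ n⟩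
  · apply le_antisymm
    · rw [hcard]
      have := natDegree_coeff_add_le_of_dvd_diffPoly hx hG'dvd (j := n)
        (by intro h0; rw [h0, natDegree_zero] at hn; exact hn rfl)
      omega
    · have hne : (G'.coeff n).map κ - C (σ (G'.coeff n)) ≠ 0 := by
        intro h0
        have : ((G'.coeff n).map κ - C (σ (G'.coeff n))).natDegree = (G'.coeff n).natDegree := by
          rw [natDegree_sub_C, natDegree_map]
        rw [h0, natDegree_zero] at this
        exact hn this.symm
      have h1 := card_le_degree_of_subset_roots (p := (G'.coeff n).map κ - C (σ (G'.coeff n)))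
        (Z := (G'.map σ).roots.toFinset) (by
          intro ζ hζ
          rw [Finset.mem_val, hmem] at hζ
          rw [mem_roots hne, IsRoot, eval_sub, eval_C, eval_map, hcoef ζ hζ, sub_self])
      rwa [natDegree_sub_C, natDegree_map] at h1
  · rw [hcard]; exact hdegle

/-- **Theorem of Engström**: if `a ∘ x = b ∘ y`, then `x` and `y` have a common right
compositional factor of degree `gcd (deg x) (deg y)`. -/
theorem exists_common_right_factor [IsAlgClosed K] [CharZero K] {a b x y : K[X]}
    (ha : a.natDegree ≠ 0) (hx : x.natDegree ≠ 0) (hab : a.comp x = b.comp y) :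
    ∃ w x₀ y₀ : K[X], x = x₀.comp w ∧ y = y₀.comp w ∧
      w.natDegree = Nat.gcd x.natDegree y.natDegree := by
  obtain ⟨h, hhx, hhy, hh⟩ := exists_dvd_diffPoly_gcd_le ha hx hab
  have hgcd : 0 < Nat.gcd x.natDegree y.natDegree := Nat.gcd_pos_of_pos_left _ (by omega)
  obtain ⟨Ω, _, σ, S, w, hσ, hS, hwS, hhS⟩ := exists_common_values hx hhx hhy (by omega)
  have hw0 : w.leadingCoeff ≠ 0 := by
    rw [Ne, leadingCoeff_eq_zero]; rintro rfl; rw [natDegree_zero] at hwS; omega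
  have hdeg : (w * C w.leadingCoeff⁻¹).natDegree = w.natDegree :=
    natDegree_mul_C (inv_ne_zero hw0)
  have key := exists_eq_comp_of_eval₂_eq hσ (S := S) (w := w * C w.leadingCoeff⁻¹)
    (monic_mul_leadingCoeff_inv (leadingCoeff_ne_zero.mp hw0)) (by rw [hdeg, hwS])
    (by rw [hdeg]; omega) (by
      intro ζ hζ
      rw [eval₂_mul, (hS ζ hζ).2.2, eval₂_C, map_mul, RingHom.comp_apply])
  obtain ⟨x₀, hx₀⟩ := key x fun ζ hζ => (hS ζ hζ).1
  obtain ⟨y₀, hy₀⟩ := key y fun ζ hζ => (hS ζ hζ).2.1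
  refine ⟨_, x₀, y₀, hx₀, hy₀, ?_⟩
  apply Nat.dvd_antisymm
  · apply Nat.dvd_gcd
    · conv_rhs => rw [hx₀, natDegree_comp]
      exact dvd_mul_left _ _
    · conv_rhs => rw [hy₀, natDegree_comp]
      exact dvd_mul_left _ _
  · have h1 : (w * C w.leadingCoeff⁻¹).natDegree ∣ Nat.gcd x.natDegree y.natDegree := by
      apply Nat.dvd_gcd
      · conv_rhs => rw [hx₀, natDegree_comp]
        exact dvd_mul_left _ _
      · conv_rhs => rw [hy₀, natDegree_comp]
        exact dvd_mul_left _ _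
    have h2 := Nat.le_of_dvd hgcd h1
    have : (w * C w.leadingCoeff⁻¹).natDegree = Nat.gcd x.natDegree y.natDegree := by omega
    rw [this]

theorem exists_eq_comp_of_natDegree_dvd [IsAlgClosed K] [CharZero K] {a b x y : K[X]}
    (ha : a.natDegree ≠ 0) (hx : x.natDegree ≠ 0) (hab : a.comp x = b.comp y)
    (hxy : x.natDegree ∣ y.natDegree) : ∃ q : K[X], y = q.comp x := by
  obtain ⟨w, x₀, y₀, hxw, hyw, hw⟩ := exists_common_right_factor ha hx hab
  rw [Nat.gcd_eq_left hxy] at hw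
  have h1 : x₀.natDegree = 1 := by
    have h2 := congrArg natDegree hxw
    rw [natDegree_comp, hw] at h2
    exact Nat.eq_of_mul_eq_mul_right (Nat.pos_of_ne_zero hx) (by rw [one_mul]; exact h2.symm)
  obtain ⟨l, -, -, hl⟩ := exists_linear_inverse h1
  refine ⟨y₀.comp l, ?_⟩
  rw [comp_assoc, hxw, ← comp_assoc l, hl, X_comp, hyw]

end Engstrom

section Ramification

variable {K : Type} [Field K]

/-- The ramification index of the polynomial map `p` at `x`. -/
noncomputable def ramIdx (p : K[X]) (x : K) : ℕ := (p - C (p.eval x)).rootMultiplicity x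

open Classical in
/-- The set of preimages of `c` under `p`. -/
noncomputable def polyFiber (p : K[X]) (c : K) : Finset K := (p - C c).roots.toFinset

/-- The set of unramified preimages of `c` under `p`. -/
noncomputable def simpleFiber (p : K[X]) (c : K) : Finset K :=
  (polyFiber p c).filter fun x => ramIdx p x = 1

theorem sub_C_ne_zero_of_natDegree {p : K[X]} (hp : p.natDegree ≠ 0) (c : K) : p - C c ≠ 0 := by
  intro h
  rw [sub_eq_zero.mp h, natDegree_C] at hp
  exact hp rfl

theorem mem_polyFiber {p : K[X]} (hp : p.natDegree ≠ 0) {c x : K} :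
    x ∈ polyFiber p c ↔ p.eval x = c := by
  classical
  rw [polyFiber, Multiset.mem_toFinset, mem_roots (sub_C_ne_zero_of_natDegree hp c), IsRoot,
    eval_sub, eval_C, sub_eq_zero]

theorem mem_simpleFiber {p : K[X]} (hp : p.natDegree ≠ 0) {c x : K} :
    x ∈ simpleFiber p c ↔ p.eval x = c ∧ ramIdx p x = 1 := by
  rw [simpleFiber, Finset.mem_filter, mem_polyFiber hp]

theorem ramIdx_pos {p : K[X]} (hp : p.natDegree ≠ 0) (x : K) : 0 < ramIdx p x := by
  rw [ramIdx, rootMultiplicity_pos (sub_C_ne_zero_of_natDegree hp _)]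
  simp

theorem ramIdx_comp {p q : K[X]} (hp : p.natDegree ≠ 0) (hq : q.natDegree ≠ 0) (x : K) :
    ramIdx (p.comp q) x = ramIdx p (q.eval x) * ramIdx q x := by
  classical
  have hp0 := sub_C_ne_zero_of_natDegree hp (p.eval (q.eval x))
  obtain ⟨r, hr, hrx⟩ := exists_eq_pow_rootMultiplicity_mul_and_not_dvd _ hp0 (q.eval x)
  have h1 : p.comp q - C ((p.comp q).eval x) =
      (q - C (q.eval x)) ^ ramIdx p (q.eval x) * r.comp q := by
    have := congrArg (fun t => t.comp q) hr
    simpa [ramIdx] using this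
  have hne : p.comp q - C ((p.comp q).eval x) ≠ 0 :=
    sub_C_ne_zero_of_natDegree (by rw [natDegree_comp]; exact mul_ne_zero hp hq) _
  rw [ramIdx, h1, rootMultiplicity_mul (h1 ▸ hne), ← count_roots, roots_pow,
    Multiset.count_nsmul, count_roots,
    rootMultiplicity_eq_zero (p := r.comp q) (by
      rw [IsRoot, eval_comp]
      exact fun h => hrx (dvd_iff_isRoot.mpr h)), add_zero]
  rfl

theorem rootMultiplicity_derivative [CharZero K] (p : K[X]) (x : K) :
    (derivative p).rootMultiplicity x = ramIdx p x - 1 := by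
  have h : derivative p = derivative (p - C (p.eval x)) := by simp
  rw [h, derivative_rootMultiplicity_of_root (by simp), ramIdx]

theorem sum_ramIdx [IsAlgClosed K] (p : K[X]) (c : K) :
    ∑ x ∈ polyFiber p c, ramIdx p x = p.natDegree := by
  classical
  rw [← natDegree_sub_C (p := p) (a := c), ← IsAlgClosed.card_roots_eq_natDegree,
    ← Multiset.toFinset_sum_count_eq, polyFiber]
  apply Finset.sum_congr rfl
  intro x hx
  rw [Multiset.mem_toFinset] at hx
  have : p.eval x = c := by
    have := (mem_roots'.mp hx).2
    rwa [IsRoot, eval_sub, eval_C, sub_eq_zero] at this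
  rw [count_roots, ramIdx, this]

theorem card_polyFiber_le [IsAlgClosed K] {p : K[X]} (hp : p.natDegree ≠ 0) (c : K) :
    (polyFiber p c).card ≤ p.natDegree := by
  rw [← sum_ramIdx p c, Finset.card_eq_sum_ones]
  exact Finset.sum_le_sum fun x _ => ramIdx_pos hp x

theorem sum_ramIdx_sub_one [IsAlgClosed K] {p : K[X]} (hp : p.natDegree ≠ 0) (c : K) :
    ∑ x ∈ polyFiber p c, (ramIdx p x - 1) = p.natDegree - (polyFiber p c).card := by
  rw [Finset.sum_tsub_distrib _ fun x _ => ramIdx_pos hp x, sum_ramIdx, Finset.card_eq_sum_ones]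

theorem sum_ramIdx_sub_one_le [IsAlgClosed K] [CharZero K] (p : K[X])
    (A : Finset K) : ∑ x ∈ A, (ramIdx p x - 1) ≤ p.natDegree - 1 := by
  classical
  have h1 : ∑ x ∈ A, (ramIdx p x - 1) = ∑ x ∈ A, Multiset.count x (derivative p).roots :=
    Finset.sum_congr rfl fun x _ => by rw [count_roots, rootMultiplicity_derivative]
  rw [h1, ← natDegree_derivative p, ← IsAlgClosed.card_roots_eq_natDegree,
    ← Multiset.toFinset_sum_count_eq]
  exact Finset.sum_le_sum_of_ne_zero fun x _ hx =>
    Multiset.mem_toFinset.mpr (Multiset.count_ne_zero.mp hx)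

theorem sum_deg_sub_card_polyFiber_le [IsAlgClosed K] [CharZero K] {p : K[X]}
    (hp : p.natDegree ≠ 0) (S : Finset K) :
    ∑ c ∈ S, (p.natDegree - (polyFiber p c).card) ≤ p.natDegree - 1 := by
  classical
  refine le_trans (le_of_eq ?_) (sum_ramIdx_sub_one_le p (S.biUnion (polyFiber p)))
  rw [Finset.sum_biUnion]
  · exact Finset.sum_congr rfl fun c _ => (sum_ramIdx_sub_one hp c).symm
  · intro a _ b _ hab
    rw [Function.onFun, Finset.disjoint_left]
    intro x hxa hxb
    rw [mem_polyFiber hp] at hxa hxb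
    exact hab (hxa.symm.trans hxb)

/-- The critical values of a polynomial. -/
noncomputable def critValues (p : K[X]) : Finset K :=
  open Classical in (derivative p).roots.toFinset.image fun x => p.eval x

theorem mem_critValues_of_ramIdx [CharZero K] {p : K[X]} (hp : p.natDegree ≠ 0) {x : K}
    (hx : ramIdx p x ≠ 1) : p.eval x ∈ critValues p := by
  classical
  refine Finset.mem_image_of_mem (fun x => p.eval x) (Multiset.mem_toFinset.mpr ?_)
  rw [← Multiset.count_pos, count_roots, rootMultiplicity_derivative]
  have := ramIdx_pos hp x
  omega

theorem sum_critValues [IsAlgClosed K] [CharZero K] {p : K[X]} (hp : p.natDegree ≠ 0) :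
    ∑ c ∈ critValues p, (p.natDegree - (polyFiber p c).card) = p.natDegree - 1 := by
  classical
  apply le_antisymm (sum_deg_sub_card_polyFiber_le hp _)
  have h1 : ∑ c ∈ critValues p, (p.natDegree - (polyFiber p c).card) =
      ∑ x ∈ (critValues p).biUnion (polyFiber p), (ramIdx p x - 1) := by
    rw [Finset.sum_biUnion]
    · exact Finset.sum_congr rfl fun c _ => (sum_ramIdx_sub_one hp c).symm
    · intro a _ b _ hab
      rw [Function.onFun, Finset.disjoint_left]
      intro x hxa hxb
      rw [mem_polyFiber hp] at hxa hxb
      exact hab (hxa.symm.trans hxb)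
  rw [h1, ← natDegree_derivative p, ← IsAlgClosed.card_roots_eq_natDegree,
    ← Multiset.toFinset_sum_count_eq]
  calc _ = ∑ x ∈ (derivative p).roots.toFinset, (ramIdx p x - 1) :=
        Finset.sum_congr rfl fun x _ => by rw [count_roots, rootMultiplicity_derivative]
    _ ≤ _ := Finset.sum_le_sum_of_subset fun x hx => by
        rw [Finset.mem_biUnion]
        exact ⟨p.eval x, Finset.mem_image_of_mem (fun x => p.eval x) hx, (mem_polyFiber hp).mpr rfl⟩

theorem two_mul_card_polyFiber_le [IsAlgClosed K] {p : K[X]} (hp : p.natDegree ≠ 0) (c : K) :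
    2 * (polyFiber p c).card ≤ p.natDegree + (simpleFiber p c).card := by
  rw [← sum_ramIdx p c, simpleFiber, Finset.card_filter, ← Finset.sum_add_distrib, mul_comm,
    Finset.card_eq_sum_ones, Finset.sum_mul]
  refine Finset.sum_le_sum fun x _ => ?_
  have := ramIdx_pos hp x
  split_ifs <;> omega

theorem card_polyFiber_comp_le [IsAlgClosed K] {p q : K[X]} (hp : p.natDegree ≠ 0)
    (hq : q.natDegree ≠ 0) (c : K) :
    (polyFiber (p.comp q) c).card ≤ (polyFiber p c).card * q.natDegree := by
  classical
  have hpq : (p.comp q).natDegree ≠ 0 := by rw [natDegree_comp]; exact mul_ne_zero hp hq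
  calc (polyFiber (p.comp q) c).card ≤ ((polyFiber p c).biUnion (polyFiber q)).card :=
        Finset.card_le_card fun x hx => by
          rw [mem_polyFiber hpq, eval_comp] at hx
          exact Finset.mem_biUnion.mpr
            ⟨q.eval x, (mem_polyFiber hp).mpr hx, (mem_polyFiber hq).mpr rfl⟩
    _ ≤ _ := Finset.card_biUnion_le_card_mul _ _ _ fun y _ => card_polyFiber_le hq y

theorem card_simpleFiber_comp_le [IsAlgClosed K] {p q : K[X]} (hp : p.natDegree ≠ 0)
    (hq : q.natDegree ≠ 0) (c : K) :
    (simpleFiber (p.comp q) c).card ≤ (simpleFiber p c).card * q.natDegree := by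
  classical
  have hpq : (p.comp q).natDegree ≠ 0 := by rw [natDegree_comp]; exact mul_ne_zero hp hq
  calc (simpleFiber (p.comp q) c).card ≤ ((simpleFiber p c).biUnion (polyFiber q)).card :=
        Finset.card_le_card fun x hx => by
          rw [mem_simpleFiber hpq, eval_comp, ramIdx_comp hp hq] at hx
          exact Finset.mem_biUnion.mpr
            ⟨q.eval x, (mem_simpleFiber hp).mpr ⟨hx.1, Nat.dvd_one.mp ⟨_, hx.2.symm⟩⟩,
              (mem_polyFiber hq).mpr rfl⟩
    _ ≤ _ := Finset.card_biUnion_le_card_mul _ _ _ fun y _ => card_polyFiber_le hq y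

theorem card_polyFiber_le_comp {p q : K[X]} (hp : p.natDegree ≠ 0)
    (hq : q.natDegree ≠ 0) (x : K) :
    (polyFiber q x).card ≤ (polyFiber (p.comp q) (p.eval x)).card := by
  have hpq : (p.comp q).natDegree ≠ 0 := by rw [natDegree_comp]; exact mul_ne_zero hp hq
  apply Finset.card_le_card
  intro y hy
  rw [mem_polyFiber hq] at hy
  rw [mem_polyFiber hpq, eval_comp, hy]

theorem card_simpleFiber_le_comp {p q : K[X]} (hp : p.natDegree ≠ 0)
    (hq : q.natDegree ≠ 0) {x : K} (hx : ramIdx p x = 1) :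
    (simpleFiber q x).card ≤ (simpleFiber (p.comp q) (p.eval x)).card := by
  have hpq : (p.comp q).natDegree ≠ 0 := by rw [natDegree_comp]; exact mul_ne_zero hp hq
  apply Finset.card_le_card
  intro y hy
  rw [mem_simpleFiber hq] at hy
  rw [mem_simpleFiber hpq, eval_comp, hy.1, ramIdx_comp hp hq, hy.1, hx, hy.2]
  exact ⟨rfl, rfl⟩

end Ramification

section CoprimeFibers

variable {K : Type} [Field K]

theorem eq_zero_of_sum_comp_mul_pow {P Q : K[X]} (hP : P.natDegree ≠ 0)
    (hPQ : Nat.Coprime P.natDegree Q.natDegree) (hQ : Q ≠ 0) {r : ℕ → K[X]}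
    (hsum : ∑ j ∈ Finset.range P.natDegree, (r j).comp P * Q ^ j = 0) :
    ∀ j < P.natDegree, r j = 0 := by
  have hne : ∀ j, r j ≠ 0 → (r j).comp P * Q ^ j ≠ 0 := by
    intro j hj
    refine mul_ne_zero (fun h => ?_) (pow_ne_zero _ hQ)
    rcases comp_eq_zero_iff.mp h with h1 | ⟨_, h1⟩
    · exact hj h1
    · exact hP (by rw [h1, natDegree_C])
  have hdeg : ∀ j, r j ≠ 0 → ((r j).comp P * Q ^ j).natDegree =
      (r j).natDegree * P.natDegree + j * Q.natDegree := by
    intro j hj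
    have h1 := hne j hj
    rw [natDegree_mul (left_ne_zero_of_mul h1) (right_ne_zero_of_mul h1), natDegree_comp,
      natDegree_pow]
  have key := degree_sum_eq_of_disjoint (fun j => (r j).comp P * Q ^ j)
    (Finset.range P.natDegree) (by
      rintro i ⟨hi, hi0⟩ j ⟨hj, hj0⟩ hij heq
      rw [Finset.mem_range] at hi hj
      have hri : r i ≠ 0 := by rintro h; simp [h] at hi0
      have hrj : r j ≠ 0 := by rintro h; simp [h] at hj0
      have h2 : ((r i).comp P * Q ^ i).natDegree = ((r j).comp P * Q ^ j).natDegree :=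
        natDegree_eq_of_degree_eq heq
      rw [hdeg i hri, hdeg j hrj] at h2
      have h3 : i * Q.natDegree ≡ j * Q.natDegree [MOD P.natDegree] := by
        have := congrArg (· % P.natDegree) h2
        simpa [Nat.ModEq, Nat.add_mod, Nat.mul_mod] using this
      have h4 := Nat.ModEq.cancel_right_of_coprime hPQ h3
      rw [Nat.ModEq, Nat.mod_eq_of_lt hi, Nat.mod_eq_of_lt hj] at h4
      exact hij h4)
  intro j hj
  by_contra hrj
  rw [hsum, degree_zero] at key
  have h1 := Finset.le_sup (f := fun j => degree ((r j).comp P * Q ^ j)) (Finset.mem_range.mpr hj)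
  have h2 : degree ((r j).comp P * Q ^ j) ≤ ⊥ := by
    rw [key]; exact h1
  exact hne j hrj (degree_eq_bot.mp (le_bot_iff.mp h2))

theorem exists_common_preimage [IsAlgClosed K] {P₀ P₁ Q₀ Q₁ : K[X]}
    (hcomm : P₀.comp Q₁ = Q₀.comp P₁) (hP : P₀.natDegree = P₁.natDegree)
    (hP0 : P₁.natDegree ≠ 0) (hQ0 : Q₁.natDegree ≠ 0)
    (hcop : Nat.Coprime P₁.natDegree Q₁.natDegree) {x y : K} (hxy : P₀.eval x = Q₀.eval y) :
    ∃ z, P₁.eval z = y ∧ Q₁.eval z = x := by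
  by_contra! hcon
  have hcopr : IsCoprime (P₁ - C y) (Q₁ - C x) := by
    rw [isCoprime_iff_aeval_ne_zero_of_isAlgClosed K K]
    intro z
    rw [coe_aeval_eq_eval, eval_sub, eval_C, eval_sub, eval_C, sub_ne_zero, sub_ne_zero]
    by_cases h : P₁.eval z = y
    · exact Or.inr (hcon z h)
    · exact Or.inl h
  let ψ : K[X][X] →+* K[X] := eval₂RingHom (compRingHom P₁) Q₁
  let ev : K[X][X] →+* K := eval₂RingHom (evalRingHom y) x
  have hlc : ∀ {p : K[X]}, p.natDegree ≠ 0 → p.leadingCoeff ≠ 0 := fun {p} hp => by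
    rw [Ne, leadingCoeff_eq_zero]; rintro rfl; exact hp natDegree_zero
  have hlc0 : P₀.leadingCoeff ≠ 0 := hlc (hP ▸ hP0)
  let m : K[X][X] := C (C P₀.leadingCoeff⁻¹) * (P₀.map C - C Q₀)
  have hmdeg : m.natDegree = P₁.natDegree := by
    rw [natDegree_C_mul (by simpa using hlc0), natDegree_sub_C, natDegree_map, hP]
  have hmonic : m.Monic := by
    have h1 : (P₀.map C - C Q₀ : K[X][X]).leadingCoeff = C P₀.leadingCoeff := by
      rw [leadingCoeff, natDegree_sub_C, natDegree_map, coeff_sub, coeff_C,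
        if_neg (hP ▸ hP0), sub_zero, coeff_map, leadingCoeff]
    rw [Monic, leadingCoeff_mul, h1, leadingCoeff_C, ← C_mul, inv_mul_cancel₀ hlc0, C_1]
  have hψm : ψ m = 0 := by
    have h1 : ψ (P₀.map C) = P₀.comp Q₁ := by
      have : (compRingHom P₁).comp C = (C : K →+* K[X]) := by ext; simp
      simp only [ψ, coe_eval₂RingHom, eval₂_map, this]
      rfl
    have h2 : ψ (C Q₀) = Q₀.comp P₁ := by simp [ψ]
    rw [map_mul, map_sub, h1, h2, hcomm, sub_self, mul_zero]
  have hevm : ev m = 0 := by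
    have h1 : ev (P₀.map C) = P₀.eval x := by
      have : (evalRingHom y).comp C = RingHom.id K := by ext; simp
      simp only [ev, coe_eval₂RingHom, eval₂_map, this]
      rfl
    have h2 : ev (C Q₀) = Q₀.eval y := by simp [ev]
    rw [map_mul, map_sub, h1, h2, hxy, sub_self, mul_zero]
  have hker : RingHom.ker ψ ≤ RingHom.ker ev := by
    intro r hr
    rw [RingHom.mem_ker] at hr ⊢
    have hmod : r %ₘ m = 0 := by
      have h1 : ψ (r %ₘ m) = 0 := by
        rw [modByMonic_eq_sub_mul_div, map_sub, map_mul, hr, hψm, zero_mul, sub_zero]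
      have h2 : (r %ₘ m).natDegree < P₁.natDegree := by
        rw [← hmdeg]
        exact natDegree_modByMonic_lt r hmonic fun h => by
          rw [h, natDegree_one] at hmdeg; exact hP0 hmdeg.symm
      have h3 : ψ (r %ₘ m) =
          ∑ j ∈ Finset.range P₁.natDegree, ((r %ₘ m).coeff j).comp P₁ * Q₁ ^ j :=
        eval₂_eq_sum_range' _ h2 _
      have h4 := eq_zero_of_sum_comp_mul_pow hP0 hcop
        (fun h => hQ0 (by rw [h, natDegree_zero])) (h3 ▸ h1)
      ext1 j
      rw [coeff_zero]
      by_cases hj : j < P₁.natDegree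
      · exact h4 j hj
      · exact coeff_eq_zero_of_natDegree_lt (by omega)
    rw [← modByMonic_add_div r m, hmod, zero_add, map_mul, hevm, zero_mul]
  let _ : Algebra K[X][X] K[X] := ψ.toAlgebra
  have hX : IsIntegral K[X][X] (X : K[X]) := by
    refine ⟨C (C (C P₁.leadingCoeff⁻¹)) * ((P₁.map (C.comp C)) - C (C X)), ?_, ?_⟩
    · have h1 : ((P₁.map (C.comp C)) - C (C X) : K[X][X][X]).leadingCoeff =
          C (C P₁.leadingCoeff) := by
        rw [leadingCoeff, natDegree_sub_C, natDegree_map, coeff_sub, coeff_C,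
          if_neg hP0, sub_zero, coeff_map, leadingCoeff]
        rfl
      rw [Monic, leadingCoeff_mul, h1, leadingCoeff_C, ← C_mul, ← C_mul,
        inv_mul_cancel₀ (hlc hP0), C_1, C_1]
    · have h1 : eval₂ ψ X (P₁.map (C.comp C)) = P₁ := by
        have : ψ.comp (C.comp C) = (C : K →+* K[X]) := by ext; simp [ψ]
        rw [eval₂_map, this, eval₂_C_X]
      have h2 : ψ (C X) = P₁ := by simp [ψ]
      change eval₂ ψ X _ = 0
      rw [eval₂_mul, eval₂_sub, h1, eval₂_C, eval₂_C, h2, sub_self, mul_zero]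
  have halgint : Algebra.IsIntegral K[X][X] K[X] := by
    refine ⟨fun p => ?_⟩
    induction p using Polynomial.induction_on' with
    | add p q hp hq => exact hp.add hq
    | monomial n a =>
      rw [← C_mul_X_pow_eq_monomial]
      refine IsIntegral.mul ?_ (hX.pow n)
      have : (C a : K[X]) = algebraMap K[X][X] K[X] (C (C a)) := by
        change _ = ψ _
        simp [ψ]
      rw [this]
      exact isIntegral_algebraMap
  have hevsurj : Function.Surjective ev := fun c => ⟨C (C c), by simp [ev]⟩
  have : (RingHom.ker ev).IsMaximal := RingHom.ker_isMaximal_of_surjective ev hevsurj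
  obtain ⟨Q, hQmax, hQ⟩ := Ideal.exists_ideal_over_maximal_of_isIntegral (S := K[X])
    (RingHom.ker ev) hker
  obtain ⟨u, v, huv⟩ := hcopr
  have hmem : ∀ r, ev r = 0 → ψ r ∈ Q := by
    intro r hr
    have : r ∈ Q.comap (algebraMap K[X][X] K[X]) := by rw [hQ]; exact hr
    exact this
  have m1 : P₁ - C y ∈ Q := by
    have := hmem (C (X - C y)) (by simp [ev])
    simpa [ψ] using this
  have m2 : Q₁ - C x ∈ Q := by
    have := hmem (X - C (C x)) (by simp [ev])
    simpa [ψ] using this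
  apply hQmax.ne_top
  rw [Ideal.eq_top_iff_one, ← huv]
  exact Q.add_mem (Q.mul_mem_left _ m1) (Q.mul_mem_left _ m2)

end CoprimeFibers

section Counting

variable {K : Type} [Field K] [IsAlgClosed K] [CharZero K]

theorem card_critValues_le (p : K[X]) : (critValues p).card ≤ p.natDegree - 1 := by
  classical
  refine Finset.card_image_le.trans ((Multiset.toFinset_card_le _).trans ?_)
  rw [IsAlgClosed.card_roots_eq_natDegree, natDegree_derivative]

omit [IsAlgClosed K] in
theorem ramIdx_eq_one_of_notMem_critValues {p : K[X]} (hp : p.natDegree ≠ 0) {y z : K}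
    (hy : y ∉ critValues p) (hz : p.eval z = y) : ramIdx p z = 1 := by
  by_contra h
  exact hy (hz ▸ mem_critValues_of_ramIdx hp h)

open Classical in
theorem mul_card_polyFiber_le {P₀ P₁ Q₀ Q₁ : K[X]}
    (hcomm : P₀.comp Q₁ = Q₀.comp P₁) (hP : P₀.natDegree = P₁.natDegree)
    (hQ : Q₀.natDegree = Q₁.natDegree) (hP0 : P₁.natDegree ≠ 0) (hQ0 : Q₁.natDegree ≠ 0)
    (hcop : Nat.Coprime P₁.natDegree Q₁.natDegree) {k : ℕ} {x c : K} (hx : P₀.eval x = c)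
    (hk : k ≤ ramIdx P₀ x) :
    k * (polyFiber Q₀ c).card ≤
      Q₀.natDegree + k * (polyFiber Q₀ c ∩ critValues P₁).card := by
  have h1 : ∀ y ∈ polyFiber Q₀ c \ critValues P₁, k ≤ ramIdx Q₀ y := by
    intro y hy
    rw [Finset.mem_sdiff, mem_polyFiber (hQ ▸ hQ0)] at hy
    obtain ⟨z, hzy, hzx⟩ :=
      exists_common_preimage hcomm hP hP0 hQ0 hcop (hx.trans hy.1.symm)
    have h2 := congrArg (fun p => ramIdx p z) hcomm
    rw [ramIdx_comp (hP ▸ hP0) hQ0, ramIdx_comp (hQ ▸ hQ0) hP0, hzy, hzx,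
      ramIdx_eq_one_of_notMem_critValues hP0 hy.2 hzy, mul_one] at h2
    rw [← h2]
    exact hk.trans (Nat.le_mul_of_pos_right _ (ramIdx_pos hQ0 z))
  have h2 : k * (polyFiber Q₀ c \ critValues P₁).card ≤ Q₀.natDegree := by
    rw [← sum_ramIdx Q₀ c, mul_comm, ← smul_eq_mul]
    exact (Finset.card_nsmul_le_sum _ _ _ h1).trans
      (Finset.sum_le_sum_of_subset Finset.sdiff_subset)
  have h3 := Finset.card_sdiff_add_card_inter (polyFiber Q₀ c) (critValues P₁)
  rw [← h3, mul_add]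
  omega

omit [IsAlgClosed K] [CharZero K] in
open Classical in
theorem sum_card_polyFiber_inter_le {Q : K[X]} (hQ : Q.natDegree ≠ 0) (S E : Finset K) :
    ∑ c ∈ S, (polyFiber Q c ∩ E).card ≤ E.card := by
  rw [← Finset.card_biUnion]
  · exact Finset.card_le_card (Finset.biUnion_subset.mpr fun c _ => Finset.inter_subset_right)
  · intro a _ b _ hab
    rw [Function.onFun, Finset.disjoint_left]
    intro x hxa hxb
    rw [Finset.mem_inter, mem_polyFiber hQ] at hxa hxb
    exact hab (hxa.1.symm.trans hxb.1)

omit [IsAlgClosed K] in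
theorem exists_ramIdx_of_mem_critValues {p : K[X]} {c : K} (hc : c ∈ critValues p) :
    ∃ x, p.eval x = c ∧ 2 ≤ ramIdx p x := by
  classical
  obtain ⟨x, hx, rfl⟩ := Finset.mem_image.mp hc
  rw [Multiset.mem_toFinset, ← Multiset.count_pos, count_roots, rootMultiplicity_derivative] at hx
  exact ⟨x, rfl, by omega⟩

/-- A polynomial with few exceptional fibres in a commutative square of coprime degrees is
totally ramified over a point, or has at most two simple preimages over two points. -/
theorem exists_special_values {P₀ P₁ Q₀ Q₁ : K[X]}
    (hcomm : P₀.comp Q₁ = Q₀.comp P₁) (hP : P₀.natDegree = P₁.natDegree)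
    (hQ : Q₀.natDegree = Q₁.natDegree) (hP2 : 2 ≤ P₁.natDegree)
    (hPQ : 6 * P₁.natDegree ≤ Q₁.natDegree)
    (hcop : Nat.Coprime P₁.natDegree Q₁.natDegree) :
    (∃ c, (polyFiber P₀ c).card = 1) ∨
      ∃ c₁ c₂, c₁ ≠ c₂ ∧ (simpleFiber P₀ c₁).card + (simpleFiber P₀ c₂).card ≤ 2 := by
  classical
  have hP1 : P₁.natDegree ≠ 0 := by omega
  have hQ1 : Q₁.natDegree ≠ 0 := by omega
  have hP0 : P₀.natDegree ≠ 0 := by omega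
  have hQ0 : Q₀.natDegree ≠ 0 := by omega
  have hkey : ∀ {k : ℕ} {x c : K}, P₀.eval x = c → k ≤ ramIdx P₀ x →
      k * (polyFiber Q₀ c).card ≤ Q₀.natDegree + k * (polyFiber Q₀ c ∩ critValues P₁).card :=
    fun hx hk => mul_card_polyFiber_le hcomm hP hQ hP1 hQ1 hcop hx hk
  have hE := card_critValues_le P₁
  have hRH := fun S => sum_deg_sub_card_polyFiber_le hQ0 S
  have hex := fun S => (sum_card_polyFiber_inter_le hQ0 S (critValues P₁)).trans hE
  have hsum := sum_critValues hP0
  rcases Nat.lt_or_ge 2 (critValues P₀).card with h3 | h2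
  · exfalso
    obtain ⟨a, b, c, ha, hb, hc, hab, hac, hbc⟩ := Finset.two_lt_card_iff.mp h3
    have hS := hRH {a, b, c}
    have hX := hex {a, b, c}
    rw [Finset.sum_insert (by simp [hab, hac]), Finset.sum_pair hbc] at hS hX
    obtain ⟨x, hx, hxe⟩ := exists_ramIdx_of_mem_critValues ha
    obtain ⟨y, hy, hye⟩ := exists_ramIdx_of_mem_critValues hb
    obtain ⟨z, hz, hze⟩ := exists_ramIdx_of_mem_critValues hc
    have k1 := hkey hx hxe
    have k2 := hkey hy hye
    have k3 := hkey hz hze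
    omega
  rcases Nat.lt_or_ge 1 (critValues P₀).card with h2' | h1
  · obtain ⟨c₁, c₂, hne, hS2⟩ := Finset.card_eq_two.mp (le_antisymm h2 h2')
    right
    refine ⟨c₁, c₂, hne, ?_⟩
    have hS := hRH {c₁, c₂}
    have hX := hex {c₁, c₂}
    rw [hS2] at hsum
    rw [Finset.sum_pair hne] at hS hX hsum
    obtain ⟨x, hx, hxe⟩ := exists_ramIdx_of_mem_critValues (p := P₀) (c := c₁) (by simp [hS2])
    obtain ⟨y, hy, hye⟩ := exists_ramIdx_of_mem_critValues (p := P₀) (c := c₂) (by simp [hS2])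
    have k1 := hkey hx hxe
    have k2 := hkey hy hye
    have hle1 : ∀ x, P₀.eval x = c₁ → ramIdx P₀ x ≤ 2 := by
      intro x hx
      by_contra! h
      have k3 := hkey hx h
      omega
    have hle2 : ∀ x, P₀.eval x = c₂ → ramIdx P₀ x ≤ 2 := by
      intro x hx
      by_contra! h
      have k3 := hkey hx h
      omega
    have hcount : ∀ c, (∀ x, P₀.eval x = c → ramIdx P₀ x ≤ 2) →
        P₀.natDegree + (simpleFiber P₀ c).card = 2 * (polyFiber P₀ c).card := by
      intro c hc
      rw [← sum_ramIdx P₀ c, simpleFiber, Finset.card_filter, ← Finset.sum_add_distrib, mul_comm,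
        Finset.card_eq_sum_ones, Finset.sum_mul]
      refine Finset.sum_congr rfl fun x hx => ?_
      have h4 := hc x ((mem_polyFiber hP0).mp hx)
      have h5 := ramIdx_pos hP0 x
      split_ifs <;> omega
    have n1 := hcount c₁ hle1
    have n2 := hcount c₂ hle2
    have b1 := card_polyFiber_le hP0 c₁
    have b2 := card_polyFiber_le hP0 c₂
    omega
  · left
    rcases Nat.lt_or_ge 0 (critValues P₀).card with h1' | h0
    · obtain ⟨c, hc⟩ := Finset.card_eq_one.mp (le_antisymm h1 h1')
      rw [hc, Finset.sum_singleton] at hsum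
      have := card_polyFiber_le hP0 c
      exact ⟨c, by omega⟩
    · rw [Finset.card_eq_zero.mp (Nat.le_zero.mp h0), Finset.sum_empty] at hsum
      omega

end Counting

section Exceptional

variable {K : Type} [Field K] [IsAlgClosed K] [CharZero K]

theorem eq_of_eval_eq_of_card_polyFiber_le {f q : K[X]} (hfq : f.comp q = q.comp f)
    (hf : f.natDegree ≠ 0) {M : ℕ} (hM : 0 < M) (hq : 2 * M ≤ q.natDegree) {c x : K}
    (hc : (polyFiber (f.comp q) c).card ≤ M) (hx : f.eval x = c) : x = c := by
  classical
  by_contra hne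
  have hq0 : q.natDegree ≠ 0 := by omega
  have hdeg : (f.comp q).natDegree = q.natDegree * f.natDegree := by
    rw [natDegree_comp, mul_comm]
  have hF : (f.comp q).natDegree ≠ 0 := hdeg ▸ mul_ne_zero hq0 hf
  have h1 := sum_deg_sub_card_polyFiber_le hF {c, x}
  rw [Finset.sum_pair (Ne.symm hne)] at h1
  have h2 : (polyFiber (f.comp q) x).card ≤ (polyFiber q x).card * f.natDegree :=
    hfq ▸ card_polyFiber_comp_le hq0 hf x
  have h3 := card_polyFiber_le_comp hf hq0 x
  rw [hx] at h3
  have h4 := Nat.mul_le_mul_right f.natDegree (h3.trans hc)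
  have h5 := Nat.mul_le_mul_right f.natDegree hq
  have h6 := Nat.le_mul_of_pos_right M (Nat.pos_of_ne_zero hf)
  rw [mul_assoc] at h5
  omega

theorem eq_or_eq_of_card_simpleFiber_le {f q : K[X]} (hfq : f.comp q = q.comp f)
    (hf : f.natDegree ≠ 0) {M : ℕ} (hM : 0 < M) (hq : 4 * M ≤ q.natDegree) {c₁ c₂ x : K}
    (hne : c₁ ≠ c₂)
    (hc : (simpleFiber (f.comp q) c₁).card + (simpleFiber (f.comp q) c₂).card ≤ 2 * M)
    (hx : f.eval x = c₁ ∨ f.eval x = c₂) (hx1 : ramIdx f x = 1) : x = c₁ ∨ x = c₂ := by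
  classical
  by_contra! hxc
  have hq0 : q.natDegree ≠ 0 := by omega
  have hdeg : (f.comp q).natDegree = q.natDegree * f.natDegree := by
    rw [natDegree_comp, mul_comm]
  have hF : (f.comp q).natDegree ≠ 0 := hdeg ▸ mul_ne_zero hq0 hf
  have h1 := sum_deg_sub_card_polyFiber_le hF {x, c₁, c₂}
  rw [Finset.sum_insert (by simp [hxc]), Finset.sum_pair hne] at h1
  have h2 := two_mul_card_polyFiber_le hF c₁
  have h3 := two_mul_card_polyFiber_le hF c₂
  have h4 := two_mul_card_polyFiber_le hF x
  have h5 : (simpleFiber (f.comp q) x).card ≤ (simpleFiber q x).card * f.natDegree :=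
    hfq ▸ card_simpleFiber_comp_le hq0 hf x
  have h6 : (simpleFiber q x).card ≤ 2 * M := by
    have := card_simpleFiber_le_comp hf hq0 hx1
    rcases hx with hx | hx <;> rw [hx] at this <;> omega
  have h7 := Nat.mul_le_mul_right f.natDegree h6
  have h8 := Nat.mul_le_mul_right f.natDegree hq
  have h9 := Nat.le_mul_of_pos_right M (Nat.pos_of_ne_zero hf)
  rw [mul_assoc] at h7 h8
  omega

omit [CharZero K] in
theorem isSpecialPolyAux_of_fiber_singleton {f : K[X]} (hf : 2 ≤ f.natDegree) {c : K}
    (h : ∀ x, f.eval x = c → x = c) : IsSpecialPolyAux f := by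
  have hroots : (f - C c).roots = Multiset.replicate f.natDegree c := by
    rw [Multiset.eq_replicate, IsAlgClosed.card_roots_eq_natDegree, natDegree_sub_C]
    refine ⟨rfl, fun x hx => h x ?_⟩
    have := isRoot_of_mem_roots hx
    simpa [sub_eq_zero] using this
  have hlc : (f - C c).leadingCoeff = f.leadingCoeff := by
    apply leadingCoeff_sub_of_degree_lt
    apply degree_C_le.trans_lt
    exact natDegree_pos_iff_degree_pos.mp (by omega)
  have hf1 : f = C f.leadingCoeff * (X - C c) ^ f.natDegree + C c := by
    have := (IsAlgClosed.splits (f - C c)).eq_prod_roots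
    rw [hroots, hlc, Multiset.map_replicate, Multiset.prod_replicate] at this
    rw [← this, sub_add_cancel]
  have hl0 : f.leadingCoeff ≠ 0 := leadingCoeff_ne_zero.mpr (by rintro rfl; simp at hf)
  obtain ⟨a, ha⟩ := IsAlgClosed.exists_pow_nat_eq (f.leadingCoeff⁻¹)
    (show 0 < f.natDegree - 1 by omega)
  have ha0 : a ≠ 0 := by
    rintro rfl
    rw [zero_pow (by omega)] at ha
    exact inv_ne_zero hl0 ha.symm
  refine ⟨a, c, ha0, X ^ f.natDegree, Or.inl rfl, ?_⟩
  have h2 : f.leadingCoeff * a ^ f.natDegree = a := by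
    rw [show f.natDegree = (f.natDegree - 1) + 1 by omega, pow_succ, ha,
      mul_inv_cancel_left₀ hl0]
  conv_rhs => rw [hf1]
  simp only [add_comp, mul_comp, C_comp, X_comp, pow_comp, sub_comp, add_sub_cancel_right,
    mul_pow, ← C_pow]
  rw [← mul_assoc, ← C_mul, h2]

end Exceptional

section ChebyshevEquation

variable {K : Type} [Field K] [CharZero K]

theorem natDegree_eq_of_chebyshev_equation {d : ℕ} {r : K[X]} (hr : r ≠ 0)
    (h : (X ^ 2 - 4) * derivative (derivative r) + X * derivative r = (d : K[X]) ^ 2 * r) :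
    r.natDegree = d := by
  set j := r.natDegree with hj
  have h1 := congrArg (fun p => coeff p j) h
  have hlc : r.coeff j ≠ 0 := by
    rw [hj, coeff_natDegree]
    exact leadingCoeff_ne_zero.mpr hr
  have hj2 : r.coeff (j + 2) = 0 := coeff_eq_zero_of_natDegree_lt (by omega)
  have h4 : ((4 : K[X]) * derivative (derivative r)).coeff j = 0 := by
    rw [show (4 : K[X]) = C 4 from rfl, coeff_C_mul, coeff_derivative, coeff_derivative, hj2]
    simp
  have hX : (X * derivative r).coeff j = j * r.coeff j := by
    rcases Nat.eq_zero_or_pos j with h0 | h0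
    · simp [h0]
    · obtain ⟨i, hi⟩ := Nat.exists_eq_succ_of_ne_zero h0.ne'
      rw [hi, Nat.succ_eq_add_one, coeff_X_mul, coeff_derivative]
      push_cast
      ring
  have hX2 : (X ^ 2 * derivative (derivative r)).coeff j = j * (j - 1) * r.coeff j := by
    rcases Nat.lt_or_ge j 2 with h0 | h0
    · rw [coeff_X_pow_mul', if_neg (by omega)]
      interval_cases j <;> simp
    · obtain ⟨i, hi⟩ := Nat.exists_eq_add_of_le' h0
      rw [hi, coeff_X_pow_mul, coeff_derivative, coeff_derivative]
      push_cast
      ring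
  have hd : ((d : K[X]) ^ 2 * r).coeff j = (d : K) ^ 2 * r.coeff j := by
    rw [← C_eq_natCast, ← C_pow, coeff_C_mul]
  simp only [sub_mul, coeff_add, coeff_sub, h4, hX, hX2, hd] at h1
  have h2 : ((j : K) ^ 2 - (d : K) ^ 2) * r.coeff j = 0 := by linear_combination h1
  have h3 := sub_eq_zero.mp ((mul_eq_zero.mp h2).resolve_right hlc)
  have h5 : j ^ 2 = d ^ 2 := by exact_mod_cast h3
  exact Nat.pow_left_injective (n := 2) (by norm_num) h5

omit [CharZero K] in
theorem isChebyshevPoly_dickson (d : ℕ) : IsChebyshevPoly d (dickson 1 (1 : K) d) :=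
  fun x hx => dickson_one_one_eval_add_inv x x⁻¹ (mul_inv_cancel₀ hx) d

theorem dickson_chebyshev_equation (d : ℕ) :
    (X ^ 2 - 4) * derivative (derivative (dickson 1 (1 : K) d)) +
      X * derivative (dickson 1 (1 : K) d) = (d : K[X]) ^ 2 * dickson 1 (1 : K) d := by
  have h2 : (2 : K) ≠ 0 := two_ne_zero
  let := invertibleOfNonzero h2
  set u := C (⅟2 : K) with hu
  have hC : u * 2 = 1 := by
    rw [hu, show (2 : K[X]) = C 2 from rfl, ← C_mul, invOf_mul_self, C_1]
  have hu' : derivative u = 0 := derivative_C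
  have h := congrArg (fun p : K[X] => p.comp (u * X))
    (Chebyshev.one_sub_X_sq_mul_derivative_derivative_T_eq_poly_in_T (R := K) d)
  rw [dickson_one_one_eq_chebyshev_T, ← hu]
  simp only [Function.iterate_succ, Function.iterate_zero, Function.comp, id, sub_comp, mul_comp,
    pow_comp, X_comp, one_comp, Int.cast_natCast, natCast_comp] at h
  simp only [derivative_mul, derivative_comp, hu', derivative_X, derivative_ofNat,
    zero_mul, zero_add, mul_one]
  set t := (derivative (derivative (Chebyshev.T K d))).comp (u * X)
  linear_combination (-2) * h - 2 * (1 + 2 * u) * t * hC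

theorem eq_neg_or_eq_of_first_order_equation {d : ℕ} (hd : d ≠ 0) {g : K[X]}
    (hg : g.natDegree = d)
    (h : (X ^ 2 - 4) * derivative g ^ 2 = (d : K[X]) ^ 2 * (g ^ 2 - 4)) :
    IsChebyshevPoly d g ∨ IsChebyshevPoly d (-g) := by
  have hg' : derivative g ≠ 0 := by
    rw [Ne, derivative_eq_zero]
    omega
  have hode : (X ^ 2 - 4) * derivative (derivative g) + X * derivative g = (d : K[X]) ^ 2 * g := by
    have h1 := congrArg derivative h
    simp only [derivative_mul, derivative_sub, derivative_pow, derivative_X, derivative_ofNat,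
      derivative_natCast] at h1
    have h2 : (C 2 * derivative g) * ((X ^ 2 - 4) * derivative (derivative g) + X * derivative g) =
      (C 2 * derivative g) * ((d : K[X]) ^ 2 * g) := by
      simp only [map_ofNat, Nat.cast_ofNat] at h1 ⊢
      simp at h1
      linear_combination h1
    exact mul_left_cancel₀ (mul_ne_zero (by simp) hg') h2
  set c := dickson 1 (1 : K) d with hc
  have hcC : IsChebyshevPoly d c := isChebyshevPoly_dickson d
  have hc2 : c.eval 2 = 2 := by
    have := hcC 1 one_ne_zero
    norm_num at this
    exact this
  have hcode := dickson_chebyshev_equation (K := K) d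
  rw [← hc] at hcode
  have hc0 : c ≠ 0 := by
    intro h0
    rw [h0, eval_zero] at hc2
    exact two_ne_zero hc2.symm
  have hcd := natDegree_eq_of_chebyshev_equation hc0 hcode
  set l := g.coeff d / c.coeff d with hl
  have hcl : c.coeff d ≠ 0 := by
    rw [← hcd, coeff_natDegree]
    exact leadingCoeff_ne_zero.mpr hc0
  have hgc : g = C l * c := by
    rw [← sub_eq_zero]
    by_contra hne
    have h1 := natDegree_eq_of_chebyshev_equation (d := d) hne (by
      simp only [derivative_sub, derivative_C_mul]
      linear_combination hode - C l * hcode)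
    have h2 : (g - C l * c).coeff d = 0 := by
      rw [coeff_sub, coeff_C_mul, hl, div_mul_cancel₀ _ hcl, sub_self]
    rw [← h1, coeff_natDegree] at h2
    exact hne (leadingCoeff_eq_zero.mp h2)
  have h2 := congrArg (eval 2) h
  simp only [eval_mul, eval_sub, eval_pow, eval_X, eval_ofNat, eval_natCast, hgc, eval_C,
    hc2] at h2
  have hl2 : l ^ 2 = 1 := by
    have hd0 : (d : K) ^ 2 ≠ 0 := pow_ne_zero _ (Nat.cast_ne_zero.mpr hd)
    have h3 : (d : K) ^ 2 * (4 * (l ^ 2 - 1)) = 0 := by linear_combination -h2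
    have h4 := (mul_eq_zero.mp h3).resolve_left hd0
    exact sub_eq_zero.mp ((mul_eq_zero.mp h4).resolve_left (by norm_num))
  rcases mul_self_eq_one_iff.mp (pow_two l ▸ hl2) with h1 | h1
  · left; rw [hgc, h1]; simpa using hcC
  · right; rw [hgc, h1]; simpa using hcC

end ChebyshevEquation

section TwoValues

variable {K : Type} [Field K] [IsAlgClosed K] [CharZero K]

omit [CharZero K] [IsAlgClosed K] in
theorem rootMultiplicity_sub_C_of_ne {p : K[X]} {c x : K} (h : p.eval x ≠ c) :
    (p - C c).rootMultiplicity x = 0 := by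
  apply rootMultiplicity_eq_zero
  simpa [sub_eq_zero] using h

theorem derivative_sq_eq_of_simple_preimages {f : K[X]} (hf : f.natDegree ≠ 0) {c₁ c₂ : K}
    (hne : c₁ ≠ c₂)
    (h : ∀ x, f.eval x = c₁ ∨ f.eval x = c₂ → ramIdx f x = 1 → x = c₁ ∨ x = c₂) :
    (X - C c₁) * (X - C c₂) * derivative f ^ 2 =
      (f.natDegree : K[X]) ^ 2 * ((f - C c₁) * (f - C c₂)) := by
  classical
  have h1 := sub_C_ne_zero_of_natDegree hf c₁
  have h2 := sub_C_ne_zero_of_natDegree hf c₂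
  have h12 := mul_ne_zero h1 h2
  have hf' : derivative f ≠ 0 := by rwa [Ne, derivative_eq_zero]
  have hX : (X - C c₁) * (X - C c₂) ≠ 0 := mul_ne_zero (X_sub_C_ne_zero _) (X_sub_C_ne_zero _)
  have hR : (X - C c₁) * (X - C c₂) * derivative f ^ 2 ≠ 0 := mul_ne_zero hX (pow_ne_zero _ hf')
  have hdvd : (f - C c₁) * (f - C c₂) ∣ (X - C c₁) * (X - C c₂) * derivative f ^ 2 := by
    apply (IsAlgClosed.splits _).dvd_of_roots_le_roots h12
    rw [Multiset.le_iff_count]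
    intro x
    have hr : Multiset.count x ((X - C c₁) * (X - C c₂) * derivative f ^ 2).roots =
        Multiset.count x {c₁} + Multiset.count x {c₂} + 2 * (ramIdx f x - 1) := by
      rw [roots_mul hR, roots_mul hX, roots_pow, roots_X_sub_C, roots_X_sub_C, Multiset.count_add,
        Multiset.count_add, Multiset.count_nsmul, count_roots (derivative f),
        rootMultiplicity_derivative]
    have hl : Multiset.count x ((f - C c₁) * (f - C c₂)).roots =
        (f - C c₁).rootMultiplicity x + (f - C c₂).rootMultiplicity x := by
      rw [roots_mul h12, Multiset.count_add, count_roots, count_roots]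
    rw [hr, hl]
    have hW : f.eval x = c₁ ∨ f.eval x = c₂ →
        ramIdx f x ≤ Multiset.count x {c₁} + Multiset.count x {c₂} + 2 * (ramIdx f x - 1) := by
      intro hx
      by_cases h1 : ramIdx f x = 1
      · rcases h x hx h1 with h3 | h3 <;> rw [h3, Multiset.count_singleton_self] <;> omega
      · have := ramIdx_pos hf x
        omega
    by_cases hx1 : f.eval x = c₁
    · rw [rootMultiplicity_sub_C_of_ne (c := c₂) (by rw [hx1]; exact hne)]
      have := hW (Or.inl hx1)
      rw [ramIdx, hx1] at this ⊢
      exact this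
    · rw [rootMultiplicity_sub_C_of_ne hx1]
      by_cases hx2 : f.eval x = c₂
      · have := hW (Or.inr hx2)
        rw [ramIdx, hx2] at this ⊢
        rwa [zero_add]
      · rw [rootMultiplicity_sub_C_of_ne hx2]
        omega
  obtain ⟨k, hk⟩ := hdvd
  have hk0 : k ≠ 0 := by rintro rfl; exact hR (by rw [hk, mul_zero])
  have hdeg := congrArg natDegree hk
  rw [natDegree_mul hX (pow_ne_zero _ hf'), natDegree_mul (X_sub_C_ne_zero _) (X_sub_C_ne_zero _),
    natDegree_mul h12 hk0, natDegree_mul h1 h2, natDegree_pow, natDegree_derivative,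
    natDegree_X_sub_C, natDegree_X_sub_C, natDegree_sub_C, natDegree_sub_C] at hdeg
  obtain ⟨a, rfl⟩ := natDegree_eq_zero.mp (show k.natDegree = 0 by omega)
  have hlc : ∀ c : K, (f - C c).leadingCoeff = f.leadingCoeff := fun c =>
    leadingCoeff_sub_of_degree_lt (degree_C_le.trans_lt
      (natDegree_pos_iff_degree_pos.mp (Nat.pos_of_ne_zero hf)))
  have hlead := congrArg leadingCoeff hk
  have hlf : (derivative f).leadingCoeff = f.natDegree * f.leadingCoeff := by
    rw [leadingCoeff, natDegree_derivative, coeff_derivative, ← Nat.cast_add_one,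
      Nat.sub_add_cancel (Nat.pos_of_ne_zero hf), mul_comm]
    rfl
  rw [leadingCoeff_mul, leadingCoeff_mul, leadingCoeff_mul, leadingCoeff_mul, leadingCoeff_pow,
    leadingCoeff_X_sub_C, leadingCoeff_X_sub_C, hlc, hlc, leadingCoeff_C, hlf] at hlead
  have hl0 : f.leadingCoeff ≠ 0 := leadingCoeff_ne_zero.mpr (by rintro rfl; simp at hf)
  have ha : a = (f.natDegree : K) ^ 2 := by
    apply mul_left_cancel₀ (mul_ne_zero hl0 hl0)
    linear_combination -hlead
  rw [hk, ha, mul_comm, C_pow, C_eq_natCast]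

theorem isSpecialPolyAux_of_simple_preimages {f : K[X]} (hf : f.natDegree ≠ 0) {c₁ c₂ : K}
    (hne : c₁ ≠ c₂)
    (h : ∀ x, f.eval x = c₁ ∨ f.eval x = c₂ → ramIdx f x = 1 → x = c₁ ∨ x = c₂) :
    IsSpecialPolyAux f := by
  have h1 := derivative_sq_eq_of_simple_preimages hf hne h
  set a : K := (c₁ - c₂) / 4 with ha
  set b : K := (c₁ + c₂) / 2 with hb
  have ha0 : a ≠ 0 := div_ne_zero (sub_ne_zero.mpr hne) (by norm_num)
  set l : K[X] := C a * X + C b with hl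
  have hld : l.natDegree = 1 := natDegree_linear ha0
  obtain ⟨l', hl'd, hll', hl'l⟩ := exists_linear_inverse hld
  set g := l'.comp (f.comp l) with hg
  have hlg : l.comp g = f.comp l := by rw [hg, ← comp_assoc, hll', X_comp]
  have hgd : g.natDegree = f.natDegree := by
    rw [hg, natDegree_comp, natDegree_comp, hl'd, hld, mul_one, one_mul]
  refine ⟨a, b, ha0, g, Or.inr ?_, hlg⟩
  rw [← hgd]
  apply eq_neg_or_eq_of_first_order_equation (hgd ▸ hf) rfl
  have hCa : C a ≠ 0 := C_ne_zero.mpr ha0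
  have hlg' : f.comp l = C a * g + C b := by
    rw [← hlg, hl]; simp
  have hder : derivative g = (derivative f).comp l := by
    apply mul_left_cancel₀ hCa
    have := congrArg derivative hlg'
    rw [derivative_comp] at this
    simp only [hl, derivative_add, derivative_mul, derivative_C, derivative_X, zero_mul, zero_add,
      mul_one, add_zero] at this
    exact this.symm
  have hc1 : C c₁ = C b + 2 * C a := by
    rw [show (2 : K[X]) = C 2 from rfl, ← C_mul, ← C_add]
    congr 1
    rw [ha, hb]; ring
  have hc2 : C c₂ = C b - 2 * C a := by
    rw [show (2 : K[X]) = C 2 from rfl, ← C_mul, ← C_sub]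
    congr 1
    rw [ha, hb]; ring
  have h2 := congrArg (fun p : K[X] => p.comp l) h1
  simp only [mul_comp, sub_comp, X_comp, C_comp, pow_comp, natCast_comp, hlg', ← hder] at h2
  rw [hl, hc1, hc2] at h2
  apply mul_left_cancel₀ (pow_ne_zero 2 hCa)
  rw [hgd]
  linear_combination h2

end TwoValues

section Degrees

variable {K : Type} [Field K] [IsAlgClosed K] [CharZero K]

/-- A commutative square `F ∘ g = g ∘ F` can be reduced to one with coprime degrees. -/
theorem exists_coprime_square {F g : K[X]} (hF : F.natDegree ≠ 0) (hg : g.natDegree ≠ 0)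
    (hFg : F.comp g = g.comp F) :
    ∃ F₀ F₁ g₀ g₁ u : K[X], F₀.comp g₁ = g₀.comp F₁ ∧ F = F₀.comp u ∧
      u.natDegree = Nat.gcd F.natDegree g.natDegree ∧
      F₀.natDegree * Nat.gcd F.natDegree g.natDegree = F.natDegree ∧
      F₁.natDegree * Nat.gcd F.natDegree g.natDegree = F.natDegree ∧
      g₀.natDegree * Nat.gcd F.natDegree g.natDegree = g.natDegree ∧
      g₁.natDegree * Nat.gcd F.natDegree g.natDegree = g.natDegree := by
  set M := Nat.gcd F.natDegree g.natDegree with hM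
  have hM0 : 0 < M := Nat.gcd_pos_of_pos_left _ (Nat.pos_of_ne_zero hF)
  obtain ⟨u, g₀, F₀, hgu, hFu, hud⟩ := exists_common_right_factor hF hg hFg
  rw [Nat.gcd_comm, ← hM] at hud
  have hu0 : u.natDegree ≠ 0 := by omega
  have hF₀ : F₀.natDegree * M = F.natDegree := by rw [hFu, natDegree_comp, hud]
  have hg₀ : g₀.natDegree * M = g.natDegree := by rw [hgu, natDegree_comp, hud]
  have hsq : F₀.comp (u.comp g) = g₀.comp (u.comp F) := by
    rw [← comp_assoc, ← comp_assoc, ← hFu, ← hgu, hFg]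
  have hF₀0 : F₀.natDegree ≠ 0 := by rintro h; rw [h, zero_mul] at hF₀; exact hF hF₀.symm
  have hug0 : (u.comp g).natDegree ≠ 0 := by rw [natDegree_comp]; exact mul_ne_zero hu0 hg
  obtain ⟨v, g₁, F₁, hgv, hFv, hvd⟩ := exists_common_right_factor hF₀0 hug0 hsq
  have hvM : v.natDegree = M * M := by
    rw [hvd, natDegree_comp, natDegree_comp, hud, Nat.gcd_mul_left, Nat.gcd_comm]
  have hv0 : v.natDegree ≠ 0 := by rw [hvM]; exact mul_ne_zero hM0.ne' hM0.ne'
  refine ⟨F₀, F₁, g₀, g₁, u, ?_, hFu, hud, hF₀, ?_, hg₀, ?_⟩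
  · apply comp_right_cancel hv0
    rw [comp_assoc, comp_assoc, ← hgv, ← hFv, hsq]
  · have := congrArg natDegree hFv
    rw [natDegree_comp, natDegree_comp, hud, hvM] at this
    apply Nat.eq_of_mul_eq_mul_left hM0
    rw [this]; ring
  · have := congrArg natDegree hgv
    rw [natDegree_comp, natDegree_comp, hud, hvM] at this
    apply Nat.eq_of_mul_eq_mul_left hM0
    rw [this]; ring

theorem IsDisintegratedAux.prime_dvd_of_polyCommute {f g : K[X]} (hf : IsDisintegratedAux f)
    (hg2 : 2 ≤ g.natDegree) (hfg : CommutesWithIterate f g) {p : ℕ} (hp : p.Prime)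
    (hpf : p ∣ f.natDegree) : p ∣ g.natDegree := by
  by_contra hpg
  obtain ⟨hd, hsp⟩ := hf
  apply hsp
  obtain ⟨N, hN, hNg⟩ := hfg
  set d := f.natDegree with hdd
  have hd0 : f.natDegree ≠ 0 := by omega
  obtain ⟨A, hA⟩ : ∃ A, A = N * (4 * d) := ⟨_, rfl⟩
  obtain ⟨j, hj⟩ : ∃ j, j = 6 * d ^ A := ⟨_, rfl⟩
  obtain ⟨B, hB⟩ : ∃ B, A = B + 1 := Nat.exists_eq_succ_of_ne_zero (by
    rw [hA]; exact mul_ne_zero (by omega) (by omega))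
  have hpA : 4 * d < p ^ A := by
    calc 4 * d ≤ A := by rw [hA]; exact Nat.le_mul_of_pos_left _ hN
      _ < 2 ^ A := Nat.lt_two_pow_self
      _ ≤ p ^ A := Nat.pow_le_pow_left hp.two_le A
  have hcomm : PolyCommute (polIter f A) (polIter g j) := by
    rw [hA, polIter_mul]
    exact (hNg.polIter_left _).polIter_right _
  have hFd : (polIter f A).natDegree = d ^ A := natDegree_polIter f A
  have hgd : (polIter g j).natDegree = g.natDegree ^ j := natDegree_polIter g j
  have hF0 : (polIter f A).natDegree ≠ 0 := by rw [hFd]; exact pow_ne_zero _ hd0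
  have hg0 : (polIter g j).natDegree ≠ 0 := by rw [hgd]; exact pow_ne_zero _ (by omega)
  obtain ⟨F₀, F₁, g₀, g₁, u, hsq, hFu, hud, hF₀, hF₁, hg₀, hg₁⟩ :=
    exists_coprime_square hF0 hg0 hcomm
  rw [hFd, hgd] at hud hF₀ hF₁ hg₀ hg₁
  set M := Nat.gcd (d ^ A) (g.natDegree ^ j) with hM
  have hM0 : 0 < M := Nat.gcd_pos_of_pos_left _ (pow_pos (by omega) _)
  have hcop : Nat.Coprime F₁.natDegree g₁.natDegree := by
    have := Nat.gcd_mul_right F₁.natDegree M g₁.natDegree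
    rw [hF₁, hg₁, ← hM] at this
    exact Nat.eq_of_mul_eq_mul_right hM0 (by rw [one_mul]; exact this.symm)
  have hF01 : F₀.natDegree = F₁.natDegree := Nat.eq_of_mul_eq_mul_right hM0 (hF₀.trans hF₁.symm)
  have hg01 : g₀.natDegree = g₁.natDegree := Nat.eq_of_mul_eq_mul_right hM0 (hg₀.trans hg₁.symm)
  have hpM : Nat.Coprime (p ^ A) M := by
    apply Nat.Coprime.coprime_dvd_right (Nat.gcd_dvd_right _ _)
    exact Nat.Coprime.pow _ _ ((Nat.Prime.coprime_iff_not_dvd hp).mpr hpg)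
  have hpF : p ^ A ∣ F₁.natDegree := by
    apply hpM.dvd_of_dvd_mul_right
    rw [hF₁]
    exact pow_dvd_pow_of_dvd hpf A
  have hF1pos : 0 < F₁.natDegree := by
    rcases Nat.eq_zero_or_pos F₁.natDegree with h | h
    · rw [h, zero_mul] at hF₁
      exact absurd hF₁.symm (pow_ne_zero _ (by omega))
    · exact h
  have hF1big : 4 * d < F₁.natDegree := hpA.trans_le (Nat.le_of_dvd hF1pos hpF)
  have hFg : 6 * F₁.natDegree ≤ g₁.natDegree := by
    apply Nat.le_of_mul_le_mul_right _ hM0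
    rw [mul_assoc, hF₁, hg₁, ← hj]
    exact (Nat.lt_two_pow_self).le.trans (Nat.pow_le_pow_left hg2 j)
  have hq : 4 * M ≤ d ^ B := by
    apply Nat.le_of_mul_le_mul_left _ (show 0 < d by omega)
    rw [← pow_succ', ← hB, ← hF₁, ← mul_assoc, mul_comm d 4]
    exact Nat.mul_le_mul_right _ hF1big.le
  have hFq : polIter f A = f.comp (polIter f B) := by rw [hB, polIter_succ]
  have hfq : f.comp (polIter f B) = (polIter f B).comp f := by
    have := polyCommute_polIter_polIter f 1 B
    rwa [polIter_one] at this
  have hqd : (polIter f B).natDegree = d ^ B := natDegree_polIter f B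
  have hu0 : u.natDegree ≠ 0 := by omega
  have hF₀0 : F₀.natDegree ≠ 0 := by omega
  rcases exists_special_values hsq hF01 hg01 (by omega) hFg hcop with ⟨c, hc⟩ | ⟨c₁, c₂, hne, hc⟩
  · refine isSpecialPolyAux_of_fiber_singleton hd (c := c) fun x hx => ?_
    refine eq_of_eval_eq_of_card_polyFiber_le hfq hd0 hM0 (by omega) ?_ hx
    rw [← hFq, hFu]
    refine (card_polyFiber_comp_le hF₀0 hu0 c).trans ?_
    rw [hc, hud, one_mul]
  · refine isSpecialPolyAux_of_simple_preimages hd0 hne fun x hx hx1 => ?_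
    refine eq_or_eq_of_card_simpleFiber_le hfq hd0 hM0 (by omega) hne ?_ hx hx1
    rw [← hFq, hFu]
    refine (Nat.add_le_add (card_simpleFiber_comp_le hF₀0 hu0 c₁)
      (card_simpleFiber_comp_le hF₀0 hu0 c₂)).trans ?_
    rw [← add_mul, hud]
    exact Nat.mul_le_mul_right _ hc

end Degrees

/-- Two natural numbers are multiplicatively dependent, or a quotient of their powers is prime
to some prime factor of the denominator. -/
theorem exists_pow_eq_pow_or_exists_coprime_quotient {d n : ℕ} (hd : 2 ≤ d) (hn : 2 ≤ n)
    (h : ∀ p : ℕ, p.Prime → p ∣ d → p ∣ n) :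
    (∃ a b, 1 ≤ a ∧ 1 ≤ b ∧ n ^ a = d ^ b) ∨
      ∃ a b p k, 1 ≤ b ∧ n ^ a = k * d ^ b ∧ 2 ≤ k ∧ p.Prime ∧ p ∣ d ∧ ¬ p ∣ k := by
  have hd0 : d ≠ 0 := by omega
  have hn0 : n ≠ 0 := by omega
  obtain ⟨p, hp, hmin⟩ := Finset.exists_min_image d.primeFactors
    (fun p => (n.factorization p : ℚ) / d.factorization p)
    (Nat.nonempty_primeFactors.mpr (by omega))
  have hpp := Nat.prime_of_mem_primeFactors hp
  have hpd := Nat.dvd_of_mem_primeFactors hp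
  set a := d.factorization p with ha
  set b := n.factorization p with hb
  have ha1 : 1 ≤ a := (hpp.dvd_iff_one_le_factorization hd0).mp hpd
  have hb1 : 1 ≤ b := (hpp.dvd_iff_one_le_factorization hn0).mp (h p hpp hpd)
  have hdvd : d ^ b ∣ n ^ a := by
    rw [← Nat.factorization_le_iff_dvd (pow_ne_zero _ hd0) (pow_ne_zero _ hn0)]
    intro q
    rw [Nat.factorization_pow, Nat.factorization_pow, Finsupp.smul_apply, Finsupp.smul_apply,
      smul_eq_mul, smul_eq_mul]
    by_cases hq : q ∈ d.primeFactors
    · have h1 := hmin q hq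
      have hq1 : 0 < d.factorization q :=
        ((Nat.prime_of_mem_primeFactors hq).dvd_iff_one_le_factorization hd0).mp
          (Nat.dvd_of_mem_primeFactors hq)
      rw [div_le_div_iff₀ (by exact_mod_cast ha1) (by exact_mod_cast hq1)] at h1
      rw [mul_comm a]
      exact_mod_cast h1
    · rw [← Nat.support_factorization, Finsupp.notMem_support_iff] at hq
      rw [hq, mul_zero]
      exact Nat.zero_le _
  obtain ⟨k, hk⟩ := hdvd
  have hk0 : k ≠ 0 := by
    rintro rfl
    rw [mul_zero] at hk
    exact pow_ne_zero _ hn0 hk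
  have hpk : ¬ p ∣ k := by
    rw [hpp.dvd_iff_one_le_factorization hk0]
    have := congrArg (fun m => m.factorization p) hk
    simp only [Nat.factorization_pow, Nat.factorization_mul (pow_ne_zero b hd0) hk0,
      Finsupp.add_apply, Finsupp.smul_apply, smul_eq_mul, ← ha, ← hb] at this
    have h2 := mul_comm a b
    omega
  by_cases hk1 : k = 1
  · exact Or.inl ⟨a, b, ha1, hb1, by rw [hk, hk1, mul_one]⟩
  · exact Or.inr ⟨a, b, p, k, hb1, by rw [hk, mul_comm], by omega, hpp, hpd, hpk⟩

section Family

variable {K : Type} [Field K] [IsAlgClosed K] [CharZero K]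

/-- Right division of polynomials commuting with an iterate of `f`. -/
theorem CommutesWithIterate.exists_eq_comp {f x y s : K[X]} {N : ℕ} (hf : f.natDegree ≠ 0)
    (hx : CommutesWithIterate f x) (hy : CommutesWithIterate f y)
    (hs : polIter f N = s.comp x) (hxy : x.natDegree ∣ y.natDegree) (hy0 : y.natDegree ≠ 0) :
    ∃ h, CommutesWithIterate f h ∧ y = h.comp x := by
  obtain ⟨m, hm, hmx⟩ := hx
  obtain ⟨n, hn, hny⟩ := hy
  have hx0 : x.natDegree ≠ 0 := by
    intro h
    rw [h, zero_dvd_iff] at hxy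
    exact hy0 hxy
  have hsd := congrArg natDegree hs
  rw [natDegree_polIter, natDegree_comp] at hsd
  have hs0 : s.natDegree ≠ 0 := by
    intro h
    rw [h, zero_mul] at hsd
    exact pow_ne_zero _ hf hsd
  obtain ⟨r, hr⟩ : ∃ r, N * n = r + N := ⟨N * n - N, by
    have := Nat.le_mul_of_pos_right N hn; omega⟩
  have hcomm : (y.comp ((polIter f r).comp s)).comp x = (polIter f (N * n)).comp y := by
    rw [comp_assoc, comp_assoc, ← hs, ← polIter_add, ← hr, mul_comm N n, polIter_mul]
    exact (hny.polIter_left N).symm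
  have ha : (y.comp ((polIter f r).comp s)).natDegree ≠ 0 := by
    rw [natDegree_comp, natDegree_comp, natDegree_polIter]
    exact mul_ne_zero hy0 (mul_ne_zero (pow_ne_zero _ hf) hs0)
  obtain ⟨h, hh⟩ := exists_eq_comp_of_natDegree_dvd ha hx0 hcomm hxy
  refine ⟨h, ⟨m * n, Nat.mul_pos hm hn, PolyCommute.of_comp hx0 (u := x) ?_ ?_⟩, hh⟩
  · rw [← hh, mul_comm, polIter_mul]
    exact hny.polIter_left _
  · rw [polIter_mul]
    exact hmx.polIter_left _

omit [IsAlgClosed K] [CharZero K] in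
theorem commutesWithIterate_polIter_self (f : K[X]) (k : ℕ) :
    CommutesWithIterate f (polIter f k) :=
  ⟨1, le_rfl, polyCommute_polIter_polIter f 1 k⟩

theorem IsDisintegratedAux.exists_pow_eq_pow {f g : K[X]} (hf : IsDisintegratedAux f)
    (hg2 : 2 ≤ g.natDegree) (hg : CommutesWithIterate f g) :
    ∃ a b, 1 ≤ a ∧ 1 ≤ b ∧ g.natDegree ^ a = f.natDegree ^ b := by
  rcases exists_pow_eq_pow_or_exists_coprime_quotient hf.1 hg2
    (fun p hp hpf => hf.prime_dvd_of_polyCommute hg2 hg hp hpf) with h | h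
  · exact h
  · obtain ⟨a, b, p, k, hb, hk, hk2, hp, hpf, hpk⟩ := h
    have hf0 : f.natDegree ≠ 0 := by have := hf.1; omega
    obtain ⟨h, hh, hgh⟩ := CommutesWithIterate.exists_eq_comp hf0
      (commutesWithIterate_polIter_self f b) (hg.polIter_iterate a) (s := X) (by rw [X_comp])
      (by rw [natDegree_polIter, natDegree_polIter, hk]; exact Dvd.intro_left k rfl)
      (by rw [natDegree_polIter]; exact pow_ne_zero _ (by omega))
    have hd := congrArg natDegree hgh
    rw [natDegree_comp, natDegree_polIter, natDegree_polIter, hk] at hd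
    have hkh := Nat.eq_of_mul_eq_mul_right (pow_pos (Nat.pos_of_ne_zero hf0) b) hd
    exact absurd (hkh ▸ hf.prime_dvd_of_polyCommute (hkh ▸ hk2) hh hp hpf) hpk

/-- Some iterate of `f` factors through any polynomial commuting with an iterate of `f`. -/
theorem IsDisintegratedAux.exists_polIter_eq_comp {f g : K[X]} (hf : IsDisintegratedAux f)
    (hg2 : 2 ≤ g.natDegree) (hg : CommutesWithIterate f g) :
    ∃ (N : ℕ) (s : K[X]), 1 ≤ N ∧ polIter f N = s.comp g := by
  obtain ⟨a, b, ha, hb, hab⟩ := hf.exists_pow_eq_pow hg2 hg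
  have hf0 : f.natDegree ≠ 0 := by have := hf.1; omega
  obtain ⟨h, hh, hgh⟩ := CommutesWithIterate.exists_eq_comp hf0
    (commutesWithIterate_polIter_self f b) (hg.polIter_iterate a) (s := X) (by rw [X_comp])
    (by rw [natDegree_polIter, natDegree_polIter, hab])
    (by rw [natDegree_polIter]; exact pow_ne_zero _ (by omega))
  have hd := congrArg natDegree hgh
  rw [natDegree_comp, natDegree_polIter, natDegree_polIter, hab] at hd
  have hd1 : h.natDegree = 1 := by
    apply Nat.eq_of_mul_eq_mul_right (pow_pos (Nat.pos_of_ne_zero hf0) b)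
    rw [← hd, one_mul]
  obtain ⟨h', -, -, hh'⟩ := exists_linear_inverse hd1
  obtain ⟨c, rfl⟩ := Nat.exists_eq_add_of_le' ha
  refine ⟨b, h'.comp (polIter g c), hb, ?_⟩
  have h1 := polIter_add g c 1
  rw [polIter_one] at h1
  rw [comp_assoc, ← h1, hgh, ← comp_assoc, hh', X_comp]

end Family

section Description

variable {K : Type} [Field K] [IsAlgClosed K] [CharZero K]

theorem IsDisintegratedAux.exists_eq_linear_comp_polIter {f ft : K[X]}
    (hf : IsDisintegratedAux f) (hft2 : 2 ≤ ft.natDegree) (hft : CommutesWithIterate f ft)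
    (hmin : ∀ g : K[X], 2 ≤ g.natDegree → CommutesWithIterate f g → ft.natDegree ≤ g.natDegree)
    {g : K[X]} (hg0 : 0 < g.natDegree) (hg : CommutesWithIterate f g) :
    ∃ (m : ℕ) (L : K[X]), L ∈ linCommSet f ∧ g = L.comp (polIter ft m) := by
  induction hn : g.natDegree using Nat.strong_induction_on generalizing g with
  | _ n ih =>
  rcases Nat.lt_or_ge g.natDegree 2 with hlt | hge
  · exact ⟨0, g, ⟨by omega, hg⟩, by rw [polIter_zero, comp_X]⟩
  · have hf0 : f.natDegree ≠ 0 := by have := hf.1; omega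
    obtain ⟨a, b, ha, hb, hab⟩ := hf.exists_pow_eq_pow hft2 hft
    obtain ⟨a', b', ha', hb', hab'⟩ := hf.exists_pow_eq_pow hge hg
    obtain ⟨N, s, -, hs⟩ := hf.exists_polIter_eq_comp hft2 hft
    have hle := hmin g hge hg
    have hpow : ft.natDegree ^ (a * b') = g.natDegree ^ (a' * b) := by
      rw [pow_mul, hab, pow_mul, hab', ← pow_mul, ← pow_mul, mul_comm]
    have hexp : a' * b ≤ a * b' := by
      rw [← Nat.pow_le_pow_iff_right (show 1 < ft.natDegree by omega), hpow]
      exact Nat.pow_le_pow_left hle _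
    have hdvd : ft.natDegree ∣ g.natDegree := by
      rw [← Nat.pow_dvd_pow_iff (mul_ne_zero (by omega) (by omega) : a' * b ≠ 0), ← hpow]
      exact pow_dvd_pow _ hexp
    obtain ⟨h, hh, rfl⟩ := CommutesWithIterate.exists_eq_comp hf0 hft hg hs hdvd hg0.ne'
    have hdeg := natDegree_comp (p := h) (q := ft)
    have hh0 : 0 < h.natDegree := by
      rw [hdeg] at hg0
      exact Nat.pos_of_mul_pos_right hg0
    have hhn : h.natDegree < n := by
      rw [← hn, hdeg]
      exact lt_mul_of_one_lt_right hh0 (by omega)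
    obtain ⟨m, L, hL, rfl⟩ := ih _ hhn hh0 hh rfl
    refine ⟨m + 1, L, hL, ?_⟩
    rw [polIter_add, polIter_one, comp_assoc]

theorem IsDisintegratedAux.exists_linear_comp_eq_comp {f ft : K[X]}
    (hf : IsDisintegratedAux f) (hft2 : 2 ≤ ft.natDegree) (hft : CommutesWithIterate f ft)
    (hmin : ∀ g : K[X], 2 ≤ g.natDegree → CommutesWithIterate f g → ft.natDegree ≤ g.natDegree)
    {L : K[X]} (hL : L ∈ linCommSet f) : ∃ L' ∈ linCommSet f, L.comp ft = ft.comp L' := by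
  obtain ⟨hL1, nL, hnL, hLc⟩ := hL
  obtain ⟨nt, hnt, htc⟩ := hft
  have hft : CommutesWithIterate f ft := ⟨nt, hnt, htc⟩
  obtain ⟨N, hN⟩ : ∃ N, N = nL * nt := ⟨_, rfl⟩
  have hN1 : 1 ≤ N := hN ▸ Nat.mul_pos hnL hnt
  have hcL : PolyCommute (polIter f N) L := by
    rw [hN, polIter_mul]; exact hLc.polIter_left _
  have hct : PolyCommute (polIter f N) ft := by
    rw [hN, mul_comm, polIter_mul]; exact htc.polIter_left _
  have hFd : 1 < (polIter f N).natDegree := by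
    rw [natDegree_polIter]
    exact Nat.one_lt_pow (by omega) hf.1
  obtain ⟨k, L₁, ⟨hL₁d, -⟩, hk⟩ := hf.exists_eq_linear_comp_polIter hft2 hft hmin
    (show 0 < (polIter f N).natDegree by omega) (commutesWithIterate_polIter_self f N)
  have htk0 : ∀ j, (polIter ft j).natDegree ≠ 0 := fun j => by
    rw [natDegree_polIter]; exact pow_ne_zero _ (by omega)
  have hc1 : PolyCommute (polIter f N) L₁ :=
    PolyCommute.of_comp (htk0 k) (by rw [← hk]; rfl) (hct.polIter_right k)
  obtain ⟨L₁', hinv_deg, hinv_right, hinv_left⟩ := exists_linear_inverse hL₁d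
  have hc1' : PolyCommute (polIter f N) L₁' :=
    PolyCommute.of_comp (u := L₁) (by omega) (by rw [hinv_left]; simp [PolyCommute]) hc1
  have hc2 : PolyCommute (polIter f N) (L₁.comp (L.comp L₁')) :=
    hc1.comp_right (hcL.comp_right hc1')
  have hswap : (polIter ft k).comp (L₁.comp (L.comp L₁')) = L.comp (polIter ft k) := by
    have h1 : (L₁.comp (polIter ft k)).comp (L₁.comp (L.comp L₁')) =
        L₁.comp (L.comp (polIter ft k)) := by
      have h2 : (polIter f N).comp (L₁.comp (L.comp L₁')) =
        (L₁.comp (L.comp L₁')).comp (polIter f N) := hc2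
      rw [← hk, h2, hk]
      simp only [comp_assoc]
      rw [← comp_assoc L₁' L₁, hinv_left, X_comp]
    have h3 := congrArg (fun p => L₁'.comp p) h1
    simpa only [← comp_assoc, hinv_left, X_comp] using h3
  obtain ⟨j, rfl⟩ : ∃ j, k = j + 1 := Nat.exists_eq_succ_of_ne_zero (by
    rintro rfl
    rw [hk, natDegree_comp, hL₁d, polIter_zero, natDegree_X] at hFd
    omega)
  have hL₂d : (L₁.comp (L.comp L₁')).natDegree = 1 := by
    rw [natDegree_comp, natDegree_comp, hL₁d, hL1, hinv_deg]
  have hd : ((polIter ft j).comp (L₁.comp (L.comp L₁'))).natDegree = ft.natDegree ^ j := by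
    rw [natDegree_comp, hL₂d, natDegree_polIter, mul_one]
  obtain ⟨i, L₃, hL₃, hi⟩ := hf.exists_eq_linear_comp_polIter hft2 hft hmin
    (hd ▸ pow_pos (by omega) j)
    ((hft.polIter_iterate j).comp ⟨N, hN1, hc2⟩)
  have hij : i = j := by
    rw [hi, natDegree_comp, hL₃.1, one_mul, natDegree_polIter] at hd
    exact Nat.pow_right_injective hft2 hd
  refine ⟨L₃, hL₃, ?_⟩
  apply comp_right_cancel (htk0 j)
  rw [comp_assoc, comp_assoc, ← polIter_succ, ← hswap, polIter_succ, comp_assoc, hi, hij]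

theorem IsDisintegratedAux.exists_linear_comp_polIter_eq {f ft : K[X]}
    (hf : IsDisintegratedAux f) (hft2 : 2 ≤ ft.natDegree) (hft : CommutesWithIterate f ft)
    (hmin : ∀ g : K[X], 2 ≤ g.natDegree → CommutesWithIterate f g → ft.natDegree ≤ g.natDegree)
    (m : ℕ) {L : K[X]} (hL : L ∈ linCommSet f) :
    ∃ L' ∈ linCommSet f, L.comp (polIter ft m) = (polIter ft m).comp L' := by
  induction m generalizing L with
  | zero => exact ⟨L, hL, by rw [polIter_zero, comp_X, X_comp]⟩
  | succ m ih =>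
    obtain ⟨L₁, hL₁, h₁⟩ := hf.exists_linear_comp_eq_comp hft2 hft hmin hL
    obtain ⟨L₂, hL₂, h₂⟩ := ih hL₁
    refine ⟨L₂, hL₂, ?_⟩
    rw [polIter_succ, ← comp_assoc, h₁, comp_assoc, h₂, comp_assoc]

end Description

/-- **Description of all polynomials commuting with an iterate of a disintegrated
polynomial** (Proposition 2.3(d)).

Let `F` be an algebraically closed field of characteristic 0, `f ∈ F[X]` a disintegrated
polynomial of degree `d ≥ 2`, `M(f^∞)` the group of linear polynomials commuting with some
iterate of `f`, and `f̃` a polynomial of lowest degree among polynomials of degree at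
least 2 commuting with some iterate of `f`. Then
`{f̃^m ∘ L : m ≥ 0, L ∈ M(f^∞)} = {L ∘ f̃^m : m ≥ 0, L ∈ M(f^∞)}`, and this set is exactly
the set of all (nonconstant) polynomials commuting with some iterate of `f`. -/
theorem commuting_polynomials_description
    (F : Type) [Field F] [IsAlgClosed F] [CharZero F]
    (d : ℕ) (hd : 2 ≤ d)
    (f : Polynomial F) (hfd : f.natDegree = d) (hdis : IsDisintegratedAux f)
    (ft : Polynomial F) (hft2 : 2 ≤ ft.natDegree)
    (hftcomm : CommutesWithIterate f ft)
    (hftmin : ∀ g : Polynomial F, 2 ≤ g.natDegree → CommutesWithIterate f g →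
      ft.natDegree ≤ g.natDegree) :
    {g : Polynomial F | ∃ (m : ℕ) (L : Polynomial F), L ∈ linCommSet f ∧
        g = (polIter ft m).comp L} =
      {g : Polynomial F | ∃ (m : ℕ) (L : Polynomial F), L ∈ linCommSet f ∧
        g = L.comp (polIter ft m)} ∧
    {g : Polynomial F | ∃ (m : ℕ) (L : Polynomial F), L ∈ linCommSet f ∧
        g = (polIter ft m).comp L} =
      {g : Polynomial F | 0 < g.natDegree ∧ CommutesWithIterate f g} := by
  have hset : ∀ g : Polynomial F, (∃ (m : ℕ) (L : Polynomial F), L ∈ linCommSet f ∧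
      g = (polIter ft m).comp L) → 0 < g.natDegree ∧ CommutesWithIterate f g := by
    rintro g ⟨m, L, ⟨hL1, hLc⟩, rfl⟩
    refine ⟨?_, (hftcomm.polIter_iterate m).comp hLc⟩
    rw [natDegree_comp, hL1, mul_one, natDegree_polIter]
    exact pow_pos (by omega) m
  have hleft : ∀ g : Polynomial F, 0 < g.natDegree ∧ CommutesWithIterate f g →
      ∃ (m : ℕ) (L : Polynomial F), L ∈ linCommSet f ∧ g = L.comp (polIter ft m) :=
    fun g hg => hdis.exists_eq_linear_comp_polIter hft2 hftcomm hftmin hg.1 hg.2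
  have hright : ∀ g : Polynomial F, (∃ (m : ℕ) (L : Polynomial F), L ∈ linCommSet f ∧
      g = L.comp (polIter ft m)) → ∃ (m : ℕ) (L : Polynomial F), L ∈ linCommSet f ∧
      g = (polIter ft m).comp L := by
    rintro g ⟨m, L, hL, rfl⟩
    obtain ⟨L', hL', h⟩ := hdis.exists_linear_comp_polIter_eq hft2 hftcomm hftmin m hL
    exact ⟨m, L', hL', h⟩
  exact ⟨Set.ext fun g => ⟨fun h => hleft g (hset g h), hright g⟩,
    Set.ext fun g => ⟨hset g, fun h => hright g (hleft g h)⟩⟩
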